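/- arXiv:2002.00921 — 7 statements merged into one kernel-verified Lean document; each statement's English description precedes it below -/
import Mathlib

section
/- For any forest H with at least one edge, there exist constants c₁, c₂ > 0 and n₀ such that for all n ≥ n₀, c₁·n² ≤ f₂(n,H) ≤ c₂·n²; and for any graph H that is not a forest, there exist constants ε > 0, c > 0 and n₀ such that for all n ≥ n₀, f₂(n,H) ≤ c·n^{2-ε}. -/
open Finset

/-- `c` is a proper edge colouring of the complete graph on `Fin n`:
it is symmetric and edges sharing a vertex receive distinct colours. -/
def IsProperEdgeColoring (n : ℕ) (c : Fin n → Fin n → ℕ) : Prop :=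
  (∀ a b, c a b = c b a) ∧
    ∀ a b b', a ≠ b → a ≠ b' → b ≠ b' → c a b ≠ c a b'

/-- The number of colours used by `c` on the edges of the complete graph on `Fin n`. -/
def numColors (n : ℕ) (c : Fin n → Fin n → ℕ) : ℕ :=
  ((Finset.univ.filter fun p : Fin n × Fin n => p.1 ≠ p.2).image fun p => c p.1 p.2).card

/-- The edge colouring `c` of the complete graph on `Fin n` contains `k` pairwise
vertex-disjoint, pairwise colour-isomorphic copies of `H`. -/
def HasRepeat (n k : ℕ) {V : Type*} (H : SimpleGraph V) (c : Fin n → Fin n → ℕ) : Prop :=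
  ∃ φ : Fin k → V → Fin n,
    (∀ i, Function.Injective (φ i)) ∧
    (∀ i j, i ≠ j → ∀ u v, φ i u ≠ φ j v) ∧
    (∀ i j, ∀ u v, H.Adj u v → c (φ i u) (φ i v) = c (φ j u) (φ j v))

/-- `repeatNumber k n H` is `f_k(n,H)`: the smallest number of colours `C` such that there
is a proper edge colouring of `K_n` with `C` colours containing no `k` pairwise
vertex-disjoint, pairwise colour-isomorphic copies of `H`. -/
noncomputable def repeatNumber (k n : ℕ) {V : Type*} (H : SimpleGraph V) : ℕ :=
  sInf { C | ∃ c : Fin n → Fin n → ℕ,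
    IsProperEdgeColoring n c ∧ numColors n c = C ∧ ¬ HasRepeat n k H c }


namespace SimpleGraph

variable {V : Type*}

/-- Every finite nonempty vertex set of a forest has a vertex with at most one neighbour
inside the set. -/
lemma IsAcyclic.exists_mem_subsingleton_neighbors {H : SimpleGraph V} (hH : H.IsAcyclic)
    {S : Finset V} (hS : S.Nonempty) :
    ∃ v ∈ S, ∀ a ∈ S, ∀ b ∈ S, H.Adj v a → H.Adj v b → a = b := by
  classical
  have : Nonempty S := hS.to_subtype
  obtain hs | hn := subsingleton_or_nontrivial S
  · obtain ⟨v, hv⟩ := hS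
    refine ⟨v, hv, fun a ha b hb _ _ => ?_⟩
    exact congrArg Subtype.val (Subsingleton.elim (⟨a, ha⟩ : S) ⟨b, hb⟩)
  · have hind : (H.comap (Subtype.val : S → V)).IsAcyclic :=
      IsAcyclic.of_comap (Function.Embedding.subtype _) hH
    obtain ⟨T, hle, -, hT⟩ :=
      (connected_top (V := S)).exists_isTree_le_of_le_of_isAcyclic le_top hind
    obtain ⟨v, hv⟩ := hT.exists_vert_degree_one_of_nontrivial
    obtain ⟨u, -, hu⟩ := degree_eq_one_iff_existsUnique_adj.mp hv
    refine ⟨v, v.2, fun a ha b hb hva hvb => ?_⟩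
    have h1 := hu ⟨a, ha⟩ (hle (by simpa using hva))
    have h2 := hu ⟨b, hb⟩ (hle (by simpa using hvb))
    exact congrArg Subtype.val (h1.trans h2.symm)

/-- A graph which is not a forest contains `m ≥ 3` distinct edges spanned by `m` vertices. -/
lemma exists_cycle_indexing {H : SimpleGraph V} (hH : ¬ H.IsAcyclic) :
    ∃ m : ℕ, 3 ≤ m ∧ ∃ (ψ : Fin m → V) (s : Fin m → Fin m), Function.Injective ψ ∧
      Function.Injective (fun i => s(i, s i)) ∧ ∀ i, H.Adj (ψ i) (ψ (s i)) := by
  rw [isAcyclic_iff_free_cycleGraph] at hH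
  push Not at hH
  obtain ⟨m, hm, hc⟩ := hH
  obtain ⟨f⟩ : (cycleGraph m).IsContained H := by simpa [Free] using hc
  obtain ⟨k, rfl⟩ : ∃ k, m = k + 3 := ⟨m - 3, by omega⟩
  refine ⟨k + 3, hm, f, fun i => i + 1, f.injective, ?_, fun i => f.toHom.map_adj ?_⟩
  · intro i j hij
    simp only [Sym2.eq_iff] at hij
    rcases hij with h | ⟨h1, h2⟩
    · exact h.1
    · exfalso
      subst h1
      have h3 : (1 : Fin (k + 3)) + 1 = 0 := by
        have : j + (1 + 1) = j + 0 := by rw [← add_assoc, h2, add_zero]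
        exact add_left_cancel this
      have h4 : 2 % (k + 3) = 0 := by simpa [Fin.val_add] using congrArg Fin.val h3
      rw [Nat.mod_eq_of_lt (by omega)] at h4
      omega
  · rw [cycleGraph_adj]
    right; simp

end SimpleGraph

/-- A dense symmetric relation on a finite set has a nonempty subset of large minimum degree. -/
lemma exists_subset_forall_lt_card_filter {X : Type*} [DecidableEq X] (R : X → X → Prop)
    [DecidableRel R] (hR : ∀ x y, R x y → R y x) (D : ℕ) (A : Finset X)
    (hA : 2 * D * #A < #{p ∈ A ×ˢ A | R p.1 p.2}) :
    ∃ S ⊆ A, S.Nonempty ∧ ∀ x ∈ S, D < #{y ∈ S | R x y} := by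
  induction A using Finset.strongInduction with
  | H A ih =>
    by_cases h : ∀ x ∈ A, D < #{y ∈ A | R x y}
    · refine ⟨A, Subset.rfl, ?_, h⟩
      rw [nonempty_iff_ne_empty]
      rintro rfl
      simp at hA
    · push Not at h
      obtain ⟨x, hx, hxD⟩ := h
      have hsub : {p ∈ A ×ˢ A | R p.1 p.2} ⊆
          {p ∈ A.erase x ×ˢ A.erase x | R p.1 p.2} ∪
            ({y ∈ A | R x y}.image (fun y => (x, y)) ∪
              {y ∈ A | R x y}.image (fun y => (y, x))) := by
        rintro ⟨a, b⟩ hab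
        simp only [mem_filter, mem_product, mem_union, mem_image, mem_erase, Prod.mk.injEq] at hab ⊢
        by_cases ha : a = x
        · subst ha
          exact Or.inr (Or.inl ⟨b, ⟨hab.1.2, hab.2⟩, rfl, rfl⟩)
        · by_cases hb : b = x
          · subst hb
            exact Or.inr (Or.inr ⟨a, ⟨hab.1.1, hR _ _ hab.2⟩, rfl, rfl⟩)
          · exact Or.inl ⟨⟨⟨ha, hab.1.1⟩, hb, hab.1.2⟩, hab.2⟩
      have h1 := card_le_card hsub
      have h2 := h1.trans ((card_union_le _ _).trans
        (Nat.add_le_add_left (card_union_le _ _) _))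
      have h3 : #({y ∈ A | R x y}.image (fun y => (x, y))) ≤ D := card_image_le.trans hxD
      have h4 : #({y ∈ A | R x y}.image (fun y => (y, x))) ≤ D := card_image_le.trans hxD
      have h5 := card_erase_add_one hx
      obtain ⟨S, hSA, hS⟩ := ih (A.erase x) (erase_ssubset hx) (by
        rw [← h5] at hA
        nlinarith)
      exact ⟨S, hSA.trans (erase_subset _ _), hS⟩

/-- Two pairs of vertices are linked when the two edges joining corresponding entries are
different edges of the same colour. -/
def Linked {n : ℕ} (c : Fin n → Fin n → ℕ) (p q : Fin n × Fin n) : Prop :=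
  p.1 ≠ p.2 ∧ q.1 ≠ q.2 ∧ p.1 ≠ q.1 ∧ p.2 ≠ q.2 ∧ c p.1 q.1 = c p.2 q.2

section

variable {n : ℕ} {c : Fin n → Fin n → ℕ}

instance : DecidableRel (Linked c) := fun _ _ => by unfold Linked; infer_instance

lemma Linked.symm (hc : IsProperEdgeColoring n c) {p q : Fin n × Fin n} (h : Linked c p q) :
    Linked c q p :=
  ⟨h.2.1, h.1, h.2.2.1.symm, h.2.2.2.1.symm, by rw [hc.1 q.1, hc.1 q.2]; exact h.2.2.2.2⟩

lemma IsProperEdgeColoring.eq_of_eq (hc : IsProperEdgeColoring n c) {a b b' : Fin n}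
    (hb : a ≠ b) (hb' : a ≠ b') (h : c a b = c a b') : b = b' := by
  by_contra hne
  exact hc.2 a b b' hb hb' hne h

lemma Linked.exists_avoiding (hc : IsProperEdgeColoring n c) {S : Finset (Fin n × Fin n)}
    {p : Fin n × Fin n} {U : Finset (Fin n)} (h : 2 * #U < #{q ∈ S | Linked c p q}) :
    ∃ q ∈ S, Linked c p q ∧ q.1 ∉ U ∧ q.2 ∉ U := by
  by_contra! hcon
  have hsub : {q ∈ S | Linked c p q} ⊆
      {q ∈ {q ∈ S | Linked c p q} | q.1 ∈ U} ∪ {q ∈ {q ∈ S | Linked c p q} | q.2 ∈ U} := by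
    intro q hq
    have hq' := mem_filter.mp hq
    simp only [mem_union, mem_filter]
    by_cases h1 : q.1 ∈ U
    · exact Or.inl ⟨hq', h1⟩
    · exact Or.inr ⟨hq', hcon q hq'.1 hq'.2 h1⟩
  have h1 : #{q ∈ {q ∈ S | Linked c p q} | q.1 ∈ U} ≤ #U := by
    refine card_le_card_of_injOn Prod.fst (fun q hq => (mem_filter.mp hq).2) ?_
    intro q hq q' hq' heq
    obtain ⟨-, -, -, h4, h5⟩ := (mem_filter.mp (mem_filter.mp hq).1).2
    obtain ⟨-, -, -, h4', h5'⟩ := (mem_filter.mp (mem_filter.mp hq').1).2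
    refine Prod.ext heq (hc.eq_of_eq h4 h4' ?_)
    rw [← h5, ← h5', heq]
  have h2 : #{q ∈ {q ∈ S | Linked c p q} | q.2 ∈ U} ≤ #U := by
    refine card_le_card_of_injOn Prod.snd (fun q hq => (mem_filter.mp hq).2) ?_
    intro q hq q' hq' heq
    obtain ⟨-, -, h4, -, h5⟩ := (mem_filter.mp (mem_filter.mp hq).1).2
    obtain ⟨-, -, h4', -, h5'⟩ := (mem_filter.mp (mem_filter.mp hq').1).2
    refine Prod.ext (hc.eq_of_eq h4 h4' ?_) heq
    rw [h5, h5', heq]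
  have := (card_le_card hsub).trans (card_union_le _ _)
  omega

/-- A forest embeds greedily, with disjoint coordinates, into a set of pairs of large minimum
degree in the relation `Linked c`. -/
lemma exists_forest_embedding (hc : IsProperEdgeColoring n c) {V : Type*} [Fintype V]
    {H : SimpleGraph V} (hH : H.IsAcyclic) {S : Finset (Fin n × Fin n)} (hS : S.Nonempty)
    (hdeg : ∀ p ∈ S, 4 * Fintype.card V < #{q ∈ S | Linked c p q}) (U : Finset V) :
    ∃ φ : V → Fin n × Fin n, (∀ u ∈ U, φ u ∈ S) ∧
      (∀ u ∈ U, ∀ v ∈ U, u ≠ v → (φ u).1 ≠ (φ v).1 ∧ (φ u).2 ≠ (φ v).2) ∧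
      (∀ u ∈ U, ∀ v ∈ U, (φ u).1 ≠ (φ v).2) ∧
      ∀ u ∈ U, ∀ v ∈ U, H.Adj u v → Linked c (φ u) (φ v) := by
  classical
  induction U using Finset.strongInduction with
  | H U ih =>
    obtain rfl | hU := U.eq_empty_or_nonempty
    · obtain ⟨p, -⟩ := hS
      exact ⟨fun _ => p, by simp⟩
    obtain ⟨v, hv, hvU⟩ := hH.exists_mem_subsingleton_neighbors hU
    obtain ⟨φ, hφS, hφne, hφ12, hφadj⟩ := ih (U.erase v) (erase_ssubset hv)
    obtain ⟨q, hqS, hqne, hq1, hq2, hqadj⟩ : ∃ q ∈ S, q.1 ≠ q.2 ∧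
        (∀ u ∈ U.erase v, q.1 ≠ (φ u).1 ∧ q.1 ≠ (φ u).2) ∧
        (∀ u ∈ U.erase v, q.2 ≠ (φ u).1 ∧ q.2 ≠ (φ u).2) ∧
        ∀ u ∈ U.erase v, H.Adj v u → Linked c (φ u) q := by
      by_cases hE : (U.erase v).Nonempty
      · obtain ⟨w, hw, hwv⟩ : ∃ w ∈ U.erase v, ∀ u ∈ U.erase v, H.Adj v u → u = w := by
          by_cases hex : ∃ w ∈ U.erase v, H.Adj v w
          · obtain ⟨w, hw, hwv⟩ := hex
            exact ⟨w, hw, fun u hu huv =>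
              hvU u (mem_of_mem_erase hu) w (mem_of_mem_erase hw) huv hwv⟩
          · push Not at hex
            obtain ⟨w, hw⟩ := hE
            exact ⟨w, hw, fun u hu huv => absurd huv (hex u hu)⟩
        obtain ⟨q, hqS, hq, h1, h2⟩ := Linked.exists_avoiding hc (S := S) (p := φ w)
          (U := (U.erase v).image (fun u => (φ u).1) ∪ (U.erase v).image (fun u => (φ u).2)) (by
            refine lt_of_le_of_lt ?_ (hdeg _ (hφS w hw))
            have h1 := card_union_le ((U.erase v).image (fun u => (φ u).1))
              ((U.erase v).image (fun u => (φ u).2))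
            have h2 : #((U.erase v).image (fun u => (φ u).1)) ≤ Fintype.card V :=
              card_image_le.trans (card_le_univ _)
            have h3 : #((U.erase v).image (fun u => (φ u).2)) ≤ Fintype.card V :=
              card_image_le.trans (card_le_univ _)
            omega)
        simp only [mem_union, mem_image, not_or, not_exists, not_and] at h1 h2
        refine ⟨q, hqS, hq.2.1, fun u hu => ⟨fun h => h1.1 u hu h.symm, fun h => h1.2 u hu h.symm⟩,
          fun u hu => ⟨fun h => h2.1 u hu h.symm, fun h => h2.2 u hu h.symm⟩, fun u hu huv => ?_⟩
        rw [hwv u hu huv]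
        exact hq
      · rw [not_nonempty_iff_eq_empty] at hE
        obtain ⟨p, hp⟩ := hS
        obtain ⟨r, hr⟩ := card_pos.mp ((Nat.zero_le _).trans_lt (hdeg p hp))
        exact ⟨p, hp, (mem_filter.mp hr).2.1, by simp [hE]⟩
    have hup : ∀ u, u ≠ v → Function.update φ v q u = φ u :=
      fun u hu => Function.update_of_ne hu _ _
    refine ⟨Function.update φ v q, ?_, ?_, ?_, ?_⟩
    · intro u hu
      by_cases huv : u = v
      · subst huv; simpa using hqS
      · rw [hup u huv]; exact hφS u (mem_erase.mpr ⟨huv, hu⟩)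
    · intro a ha b hb hab
      by_cases hav : a = v
      · subst hav
        have hb' : b ∈ U.erase a := mem_erase.mpr ⟨hab.symm, hb⟩
        rw [hup b hab.symm, Function.update_self]
        exact ⟨(hq1 b hb').1, (hq2 b hb').2⟩
      · have ha' : a ∈ U.erase v := mem_erase.mpr ⟨hav, ha⟩
        by_cases hbv : b = v
        · subst hbv
          rw [hup a hav, Function.update_self]
          exact ⟨(hq1 a ha').1.symm, (hq2 a ha').2.symm⟩
        · rw [hup a hav, hup b hbv]
          exact hφne a ha' b (mem_erase.mpr ⟨hbv, hb⟩) hab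
    · intro a ha b hb
      by_cases hav : a = v
      · subst hav
        by_cases hba : b = a
        · subst hba; simpa using hqne
        · rw [hup b hba, Function.update_self]
          exact (hq1 b (mem_erase.mpr ⟨hba, hb⟩)).2
      · have ha' : a ∈ U.erase v := mem_erase.mpr ⟨hav, ha⟩
        by_cases hbv : b = v
        · subst hbv
          rw [hup a hav, Function.update_self]
          exact (hq2 a ha').1.symm
        · rw [hup a hav, hup b hbv]
          exact hφ12 a ha' b (mem_erase.mpr ⟨hbv, hb⟩)
    · intro a ha b hb hab
      by_cases hav : a = v
      · subst hav
        rw [hup b hab.ne', Function.update_self]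
        exact (hqadj b (mem_erase.mpr ⟨hab.ne', hb⟩) hab).symm hc
      · have ha' : a ∈ U.erase v := mem_erase.mpr ⟨hav, ha⟩
        by_cases hbv : b = v
        · subst hbv
          rw [hup a hav, Function.update_self]
          exact hqadj a ha' hab.symm
        · rw [hup a hav, hup b hbv]
          exact hφadj a ha' b (mem_erase.mpr ⟨hbv, hb⟩) hab

/-- In a proper colouring without a repeated forest `H`, few pairs of pairs are linked. -/
lemma card_linked_le_of_not_hasRepeat (hc : IsProperEdgeColoring n c) {V : Type*} [Fintype V]
    {H : SimpleGraph V} (hH : H.IsAcyclic) (hrep : ¬ HasRepeat n 2 H c) :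
    #{p : (Fin n × Fin n) × (Fin n × Fin n) | Linked c p.1 p.2} ≤
      8 * Fintype.card V * n ^ 2 := by
  by_contra! hlt
  obtain ⟨S, -, hS, hdeg⟩ := exists_subset_forall_lt_card_filter (Linked c)
    (fun _ _ => Linked.symm hc) (4 * Fintype.card V) univ (by
      rw [univ_product_univ, card_univ, Fintype.card_prod, Fintype.card_fin]
      refine lt_of_eq_of_lt ?_ hlt
      ring)
  obtain ⟨φ, -, hne, h12, hadj⟩ := exists_forest_embedding hc hH hS hdeg univ
  have hinj1 : Function.Injective fun v => (φ v).1 := fun u v huv => by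
    by_contra h
    exact (hne u (mem_univ _) v (mem_univ _) h).1 huv
  have hinj2 : Function.Injective fun v => (φ v).2 := fun u v huv => by
    by_contra h
    exact (hne u (mem_univ _) v (mem_univ _) h).2 huv
  refine hrep ⟨![fun v => (φ v).1, fun v => (φ v).2], ?_, ?_, ?_⟩
  · simpa [Fin.forall_fin_two] using ⟨hinj1, hinj2⟩
  · simpa [Fin.forall_fin_two] using
      ⟨fun u v => h12 u (mem_univ _) v (mem_univ _),
        fun u v => (h12 v (mem_univ _) u (mem_univ _)).symm⟩
  · have h : ∀ u v, H.Adj u v → c (φ u).1 (φ v).1 = c (φ u).2 (φ v).2 :=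
      fun u v huv => (hadj u (mem_univ _) v (mem_univ _) huv).2.2.2.2
    simpa [Fin.forall_fin_two] using ⟨h, fun u v huv => (h u v huv).symm⟩

/-- Counting pairs of edges of the same colour by the Cauchy–Schwarz inequality. -/
lemma sq_card_offDiag_le (hc : IsProperEdgeColoring n c) :
    (n * n - n) ^ 2 ≤ numColors n c *
      (#{p : (Fin n × Fin n) × (Fin n × Fin n) | Linked c p.1 p.2} + (n * n - n)) := by
  set Q : Finset (Fin n × Fin n) := {p | p.1 ≠ p.2} with hQ
  set f : Fin n × Fin n → ℕ := fun p => c p.1 p.2 with hf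
  have hQcard : #Q = n * n - n := by
    have : Q = (univ : Finset (Fin n)).offDiag := by ext p; simp [hQ]
    rw [this, offDiag_card, card_univ, Fintype.card_fin]
  have h1 : #Q = ∑ k ∈ Q.image f, #{p ∈ Q | f p = k} :=
    card_eq_sum_card_fiberwise fun p hp => mem_image_of_mem f hp
  have h2 := sq_sum_le_card_mul_sum_sq (s := Q.image f) (f := fun k => #{p ∈ Q | f p = k})
  rw [← h1, hQcard] at h2
  refine h2.trans (Nat.mul_le_mul_left _ ?_)
  have h3 : ∑ k ∈ Q.image f, #{p ∈ Q | f p = k} ^ 2 = #{p ∈ Q ×ˢ Q | f p.1 = f p.2} := by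
    rw [card_eq_sum_card_fiberwise (f := fun p : _ × _ => f p.1) (t := Q.image f)]
    · refine sum_congr rfl fun k _ => ?_
      rw [sq, ← card_product]
      congr 1
      ext ⟨p, q⟩
      simp only [mem_product, mem_filter]
      constructor
      · rintro ⟨⟨a, b⟩, d, e⟩
        exact ⟨⟨⟨a, d⟩, b.trans e.symm⟩, b⟩
      · rintro ⟨⟨⟨a, d⟩, b⟩, e⟩
        exact ⟨⟨a, e⟩, d, b.symm.trans e⟩
    · intro p hp
      simp only [coe_filter, mem_product, Set.mem_ofPred_eq] at hp
      exact mem_image_of_mem f hp.1.1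
  rw [h3, ← hQcard]
  have hsub : {p ∈ Q ×ˢ Q | f p.1 = f p.2} ⊆
      ({p : (Fin n × Fin n) × (Fin n × Fin n) | Linked c p.1 p.2} : Finset _).image
        (fun p => ((p.1.1, p.2.1), (p.1.2, p.2.2))) ∪ Q.image (fun p => (p, p)) := by
    rintro ⟨⟨x, y⟩, ⟨x', y'⟩⟩ hp
    simp only [hQ, hf, mem_filter, mem_product, mem_univ, true_and] at hp
    obtain ⟨⟨hxy, hxy'⟩, hcol⟩ := hp
    simp only [mem_union, mem_image, mem_filter, mem_univ, true_and]
    by_cases hx : x = x'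
    · subst hx
      obtain rfl := hc.eq_of_eq hxy hxy' hcol
      exact Or.inr ⟨(x, y), by simpa [hQ] using hxy, rfl⟩
    · refine Or.inl ⟨((x, x'), (y, y')), ⟨hx, ?_, hxy, hxy', hcol⟩, rfl⟩
      intro (hy : y = y')
      subst hy
      rw [hc.1 x y, hc.1 x' y] at hcol
      exact hx (hc.eq_of_eq hxy.symm hxy'.symm hcol)
  exact (card_le_card hsub).trans ((card_union_le _ _).trans
    (Nat.add_le_add card_image_le card_image_le))

end

section

variable {n C : ℕ}

/-- The colouring which follows `f` outside the set `B` of edges, and gives each edge of `B` a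
new colour of its own. -/
noncomputable def overlay (f : Sym2 (Fin n) → Fin C) (B : Finset (Sym2 (Fin n)))
    (a b : Fin n) : ℕ :=
  if s(a, b) ∈ B then C + Fintype.equivFin (Sym2 (Fin n)) s(a, b) else f s(a, b)

variable {f : Sym2 (Fin n) → Fin C} {B : Finset (Sym2 (Fin n))}

lemma overlay_eq_of_ne {a b a' b' : Fin n} (h : overlay f B a b = overlay f B a' b')
    (hne : s(a, b) ≠ s(a', b')) : s(a, b) ∉ B ∧ f s(a, b) = f s(a', b') := by
  unfold overlay at h
  have h1 := (f s(a, b)).isLt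
  have h2 := (f s(a', b')).isLt
  split_ifs at h with hB hB' hB'
  · refine absurd ((Fintype.equivFin (Sym2 (Fin n))).injective (Fin.ext ?_)) hne
    omega
  · omega
  · omega
  · exact ⟨hB, Fin.ext h⟩

lemma isProperEdgeColoring_overlay
    (hB : ∀ a b b', a ≠ b → a ≠ b' → b ≠ b' → f s(a, b) = f s(a, b') → s(a, b) ∈ B) :
    IsProperEdgeColoring n (overlay f B) := by
  refine ⟨fun a b => by simp only [overlay, Sym2.eq_swap], fun a b b' hb hb' hbb h => ?_⟩
  have h1 := overlay_eq_of_ne h (mt Sym2.congr_right.mp hbb)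
  exact h1.1 (hB a b b' hb hb' hbb h1.2)

lemma numColors_overlay_le : numColors n (overlay f B) ≤ C + #B := by
  have hsub : (univ.filter fun p : Fin n × Fin n => p.1 ≠ p.2).image
      (fun p => overlay f B p.1 p.2) ⊆
      range C ∪ B.image (fun e => C + (Fintype.equivFin (Sym2 (Fin n)) e : ℕ)) := by
    intro k hk
    obtain ⟨⟨a, b⟩, -, rfl⟩ := mem_image.mp hk
    simp only [overlay, mem_union, mem_range, mem_image]
    split_ifs with h
    · exact Or.inr ⟨_, h, rfl⟩
    · exact Or.inl (Fin.isLt _)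
  refine (card_le_card hsub).trans ((card_union_le _ _).trans ?_)
  rw [card_range]
  exact Nat.add_le_add_left card_image_le _

lemma not_hasRepeat_overlay_univ {V : Type*} {H : SimpleGraph V} (hH : ∃ u v, H.Adj u v) :
    ¬ HasRepeat n 2 H (overlay f univ) := by
  rintro ⟨φ, -, hdisj, hcol⟩
  obtain ⟨u, v, huv⟩ := hH
  refine (overlay_eq_of_ne (hcol 0 1 u v huv) ?_).1 (mem_univ _)
  intro h
  rcases Sym2.eq_iff.mp h with h | h
  · exact hdisj 0 1 (by decide) u u h.1
  · exact hdisj 0 1 (by decide) u v h.1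

lemma isProperEdgeColoring_overlay_univ : IsProperEdgeColoring n (overlay f univ) :=
  isProperEdgeColoring_overlay fun _ _ _ _ _ _ _ => mem_univ _

end

lemma numColors_le_sq (n : ℕ) (c : Fin n → Fin n → ℕ) : numColors n c ≤ n ^ 2 := by
  refine card_image_le.trans ((card_le_univ _).trans ?_)
  rw [Fintype.card_prod, Fintype.card_fin, sq]

lemma repeatNumber_le {k n : ℕ} {V : Type*} {H : SimpleGraph V} {c : Fin n → Fin n → ℕ}
    (hc : IsProperEdgeColoring n c) (hrep : ¬ HasRepeat n k H c) :
    repeatNumber k n H ≤ numColors n c :=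
  Nat.sInf_le ⟨c, hc, rfl, hrep⟩

lemma repeatNumber_le_sq {V : Type*} {H : SimpleGraph V} (hH : ∃ u v, H.Adj u v) (n : ℕ) :
    repeatNumber 2 n H ≤ n ^ 2 :=
  (repeatNumber_le (isProperEdgeColoring_overlay_univ (f := fun _ => (0 : Fin 1)))
    (not_hasRepeat_overlay_univ hH)).trans (numColors_le_sq n _)

lemma le_repeatNumber {V : Type*} [Fintype V] {H : SimpleGraph V} (hH : H.IsAcyclic)
    (hE : ∃ u v, H.Adj u v) {n : ℕ} (hn : 2 ≤ n) :
    1 / (4 * (8 * Fintype.card V + 1) : ℝ) * (n : ℝ) ^ 2 ≤ repeatNumber 2 n H := by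
  obtain ⟨c, hc, hnum, hrep⟩ : repeatNumber 2 n H ∈ { C | ∃ c : Fin n → Fin n → ℕ,
      IsProperEdgeColoring n c ∧ numColors n c = C ∧ ¬ HasRepeat n 2 H c } :=
    Nat.sInf_mem ⟨_, overlay (fun _ => (0 : Fin 1)) univ, isProperEdgeColoring_overlay_univ, rfl,
      not_hasRepeat_overlay_univ hE⟩
  rw [← hnum]
  have h1 := sq_card_offDiag_le hc
  have h2 := card_linked_le_of_not_hasRepeat hc hH hrep
  set K := numColors n c
  set d := Fintype.card V
  have h3 : (n * n - n) ^ 2 ≤ K * ((8 * d + 1) * n ^ 2) := by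
    refine h1.trans (Nat.mul_le_mul_left _ ?_)
    have : n * n - n ≤ n ^ 2 := by rw [sq]; exact Nat.sub_le _ _
    linarith
  have h4 : n * n ≤ 2 * (n * n - n) := by
    have : 2 * n ≤ n * n := Nat.mul_le_mul_right _ hn
    omega
  have h5 : (n * n) * (n * n) ≤ 4 * (K * ((8 * d + 1) * n ^ 2)) := by
    calc (n * n) * (n * n) ≤ (2 * (n * n - n)) * (2 * (n * n - n)) := Nat.mul_le_mul h4 h4
      _ = 4 * (n * n - n) ^ 2 := by ring
      _ ≤ _ := Nat.mul_le_mul_left _ h3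
  have h6 : n ^ 2 ≤ K * (4 * (8 * d + 1)) := by
    refine Nat.le_of_mul_le_mul_right (c := n ^ 2) ?_ (by positivity)
    calc n ^ 2 * n ^ 2 = (n * n) * (n * n) := by ring
      _ ≤ _ := h5
      _ = _ := by ring
  rw [one_div, inv_mul_le_iff₀ (by positivity)]
  have h7 : (n : ℝ) ^ 2 ≤ K * (4 * (8 * d + 1)) := by exact_mod_cast h6
  linarith

section

variable {E : Type*} [Fintype E] [DecidableEq E]

lemma card_matching_functions_mul_pow_le (C l : ℕ) (e e' : Fin l → E)
    (he' : Function.Injective e') (hne : ∀ i j, e i ≠ e' j) :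
    #{f : E → Fin C | ∀ i, f (e i) = f (e' i)} * C ^ l ≤ C ^ Fintype.card E := by
  have hl : l ≤ Fintype.card E := by simpa using Fintype.card_le_of_injective e' he'
  have hcard : Fintype.card {x // x ∉ univ.image e'} = Fintype.card E - l := by
    rw [Fintype.card_subtype_compl, Fintype.card_coe, card_image_of_injective _ he', card_univ,
      Fintype.card_fin]
  have h : #{f : E → Fin C | ∀ i, f (e i) = f (e' i)} ≤ C ^ (Fintype.card E - l) := by
    rw [← hcard]
    calc _ ≤ #(univ : Finset ({x // x ∉ univ.image e'} → Fin C)) := by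
          refine card_le_card_of_injOn (fun f x => f x) (fun _ _ => by simp) ?_
          intro f hf g hg hfg
          have hf' : ∀ i, f (e i) = f (e' i) := by simpa using hf
          have hg' : ∀ i, g (e i) = g (e' i) := by simpa using hg
          have hoff : ∀ x, x ∉ univ.image e' → f x = g x := fun x hx => congrFun hfg ⟨x, hx⟩
          funext x
          by_cases hx : x ∈ univ.image e'
          · obtain ⟨i, -, rfl⟩ := mem_image.mp hx
            rw [← hf', ← hg']
            refine hoff _ fun hmem => ?_
            obtain ⟨j, -, hj⟩ := mem_image.mp hmem
            exact hne i j hj.symm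
          · exact hoff x hx
      _ = _ := by simp
  calc _ ≤ C ^ (Fintype.card E - l) * C ^ l := Nat.mul_le_mul_right _ h
    _ = _ := by rw [← pow_add, Nat.sub_add_cancel hl]

lemma sum_card_matching_le {ι : Type*} (I : Finset ι) {C : ℕ} (hC : 0 < C) (l : ℕ)
    (e e' : ι → Fin l → E) (he' : ∀ i ∈ I, Function.Injective (e' i))
    (hne : ∀ i ∈ I, ∀ j k, e i j ≠ e' i k) :
    ∑ f : E → Fin C, (#{i ∈ I | ∀ j, f (e i j) = f (e' i j)} : ℝ) ≤
      (C : ℝ) ^ Fintype.card E * (#I / (C : ℝ) ^ l) := by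
  have hswap : ∑ f : E → Fin C, #{i ∈ I | ∀ j, f (e i j) = f (e' i j)} =
      ∑ i ∈ I, #{f : E → Fin C | ∀ j, f (e i j) = f (e' i j)} := by
    simp only [card_filter]
    exact sum_comm
  have hC' : (0 : ℝ) < (C : ℝ) ^ l := by positivity
  calc ∑ f : E → Fin C, (#{i ∈ I | ∀ j, f (e i j) = f (e' i j)} : ℝ)
      = ∑ i ∈ I, (#{f : E → Fin C | ∀ j, f (e i j) = f (e' i j)} : ℝ) := by exact_mod_cast hswap
    _ ≤ ∑ i ∈ I, (C : ℝ) ^ Fintype.card E / (C : ℝ) ^ l := by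
        refine sum_le_sum fun i hi => ?_
        rw [le_div_iff₀ hC']
        exact_mod_cast card_matching_functions_mul_pow_le C l (e i) (e' i) (he' i hi) (hne i hi)
    _ = _ := by rw [sum_const, nsmul_eq_mul]; ring

end

/-- The deletion method: a random colouring in which the conflicting edges are recoloured. -/
lemma repeatNumber_le_of_cycle {V : Type*} {H : SimpleGraph V} {m : ℕ} (hm : 0 < m)
    {ψ : Fin m → V} {s : Fin m → Fin m} (hψ : Function.Injective ψ)
    (hs : Function.Injective fun i => s(i, s i)) (hadj : ∀ i, H.Adj (ψ i) (ψ (s i)))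
    (n : ℕ) {C : ℕ} (hC : 0 < C) :
    (repeatNumber 2 n H : ℝ) ≤ C + ((n : ℝ) ^ 3 / C + (n : ℝ) ^ (2 * m) / (C : ℝ) ^ m) := by
  classical
  let I₁ : Finset (Fin n × Fin n × Fin n) := {t | t.1 ≠ t.2.1 ∧ t.1 ≠ t.2.2 ∧ t.2.1 ≠ t.2.2}
  let I₂ : Finset ((Fin m → Fin n) × (Fin m → Fin n)) :=
    {p | Function.Injective p.1 ∧ Function.Injective p.2 ∧ ∀ i j, p.1 i ≠ p.2 j}
  let e₁ (t : Fin n × Fin n × Fin n) (_ : Fin 1) : Sym2 (Fin n) := s(t.1, t.2.1)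
  let e₁' (t : Fin n × Fin n × Fin n) (_ : Fin 1) : Sym2 (Fin n) := s(t.1, t.2.2)
  let e₂ (p : (Fin m → Fin n) × (Fin m → Fin n)) (i : Fin m) : Sym2 (Fin n) :=
    s(p.1 i, p.1 (s i))
  let e₂' (p : (Fin m → Fin n) × (Fin m → Fin n)) (i : Fin m) : Sym2 (Fin n) :=
    s(p.2 i, p.2 (s i))
  have hI₁ : (#I₁ : ℝ) ≤ (n : ℝ) ^ 3 := by
    have : #I₁ ≤ n ^ 3 := (card_le_univ _).trans_eq (by simp; ring)
    exact_mod_cast this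
  have hI₂ : (#I₂ : ℝ) ≤ (n : ℝ) ^ (2 * m) := by
    have : #I₂ ≤ n ^ (2 * m) := (card_le_univ _).trans_eq (by simp; ring)
    exact_mod_cast this
  have hsum₁ := sum_card_matching_le I₁ hC 1 e₁ e₁'
    (fun _ _ => Function.injective_of_subsingleton _) (fun t ht _ _ => by
      have ht' := (mem_filter.mp ht).2
      exact mt Sym2.congr_right.mp ht'.2.2)
  have hsum₂ := sum_card_matching_le I₂ hC m e₂ e₂'
    (fun p hp i j hij => hs (Sym2.map.injective (mem_filter.mp hp).2.2.1 hij))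
    (fun p hp i j hij => by
      have hp' := (mem_filter.mp hp).2.2.2
      rcases Sym2.eq_iff.mp hij with h | h
      · exact hp' _ _ h.1
      · exact hp' _ _ h.1)
  obtain ⟨f, -, hf⟩ : ∃ f ∈ (univ : Finset (Sym2 (Fin n) → Fin C)),
      (#{t ∈ I₁ | ∀ j, f (e₁ t j) = f (e₁' t j)} : ℝ) +
        #{p ∈ I₂ | ∀ j, f (e₂ p j) = f (e₂' p j)} ≤
      (n : ℝ) ^ 3 / C + (n : ℝ) ^ (2 * m) / (C : ℝ) ^ m := by
    have : Nonempty (Fin C) := ⟨⟨0, hC⟩⟩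
    refine exists_le_of_sum_le univ_nonempty ?_
    rw [sum_add_distrib, sum_const, card_univ, Fintype.card_fun, Fintype.card_fin, nsmul_eq_mul,
      mul_add]
    push_cast
    refine add_le_add (hsum₁.trans ?_) (hsum₂.trans ?_)
    · rw [pow_one]; gcongr
    · gcongr
  let B : Finset (Sym2 (Fin n)) :=
    {t ∈ I₁ | ∀ j, f (e₁ t j) = f (e₁' t j)}.image (fun t => e₁ t 0) ∪
      {p ∈ I₂ | ∀ j, f (e₂ p j) = f (e₂' p j)}.image (fun p => e₂ p ⟨0, hm⟩)
  have hproper : IsProperEdgeColoring n (overlay f B) :=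
    isProperEdgeColoring_overlay fun a b b' hb hb' hbb h =>
      mem_union_left _ (mem_image.mpr ⟨(a, b, b'),
        mem_filter.mpr ⟨mem_filter.mpr ⟨mem_univ _, hb, hb', hbb⟩, fun _ => h⟩, rfl⟩)
  have hrep : ¬ HasRepeat n 2 H (overlay f B) := by
    rintro ⟨φ, hinj, hdisj, hcol⟩
    have hne : ∀ u v u' v', s(φ 0 u, φ 0 v) ≠ s(φ 1 u', φ 1 v') := by
      intro u v u' v' h
      rcases Sym2.eq_iff.mp h with h | h
      · exact hdisj 0 1 (by decide) _ _ h.1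
      · exact hdisj 0 1 (by decide) _ _ h.1
    have hkey := fun i => overlay_eq_of_ne (hcol 0 1 _ _ (hadj i)) (hne _ _ _ _)
    refine (hkey ⟨0, hm⟩).1 (mem_union_right _ (mem_image.mpr
      ⟨(φ 0 ∘ ψ, φ 1 ∘ ψ), mem_filter.mpr ⟨mem_filter.mpr ⟨mem_univ _, (hinj 0).comp hψ,
        (hinj 1).comp hψ, fun _ _ => hdisj 0 1 (by decide) _ _⟩, fun i => (hkey i).2⟩, rfl⟩))
  have hB : #B ≤ #{t ∈ I₁ | ∀ j, f (e₁ t j) = f (e₁' t j)} +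
      #{p ∈ I₂ | ∀ j, f (e₂ p j) = f (e₂' p j)} :=
    (card_union_le _ _).trans (Nat.add_le_add card_image_le card_image_le)
  have hle : (repeatNumber 2 n H : ℝ) ≤ C + #B := by
    exact_mod_cast (repeatNumber_le hproper hrep).trans numColors_overlay_le
  have hB' : (#B : ℝ) ≤ _ := (Nat.cast_le.mpr hB).trans_eq (Nat.cast_add _ _)
  linarith

lemma repeatNumber_le_rpow {V : Type*} {H : SimpleGraph V} {m : ℕ} (hm : 3 ≤ m)
    {ψ : Fin m → V} {s : Fin m → Fin m} (hψ : Function.Injective ψ)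
    (hs : Function.Injective fun i => s(i, s i)) (hadj : ∀ i, H.Adj (ψ i) (ψ (s i)))
    {n : ℕ} (hn : 1 ≤ n) :
    (repeatNumber 2 n H : ℝ) ≤ 4 * (n : ℝ) ^ ((2 : ℝ) - 1 / m) := by
  have hn' : (1 : ℝ) ≤ n := by exact_mod_cast hn
  have hn0 : (0 : ℝ) < n := by linarith
  have hm' : (3 : ℝ) ≤ m := by exact_mod_cast hm
  have hε : (1 : ℝ) / m ≤ 1 / 3 := one_div_le_one_div_of_le (by norm_num) hm'
  set x : ℝ := (n : ℝ) ^ ((2 : ℝ) - 1 / m) with hx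
  have hx1 : 1 ≤ x := Real.one_le_rpow hn' (by linarith)
  have hCx : x ≤ ⌈x⌉₊ := Nat.le_ceil x
  have hCx' : (⌈x⌉₊ : ℝ) < x + 1 := Nat.ceil_lt_add_one (by linarith)
  have hmain := repeatNumber_le_of_cycle (by omega) hψ hs hadj n (C := ⌈x⌉₊)
    (Nat.ceil_pos.mpr (by linarith))
  have h1 : (n : ℝ) ^ 3 / ⌈x⌉₊ ≤ x := by
    rw [div_le_iff₀ (by linarith)]
    calc (n : ℝ) ^ 3 = (n : ℝ) ^ (3 : ℝ) := by norm_cast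
      _ ≤ (n : ℝ) ^ (((2 : ℝ) - 1 / m) + ((2 : ℝ) - 1 / m)) :=
        Real.rpow_le_rpow_of_exponent_le hn' (by linarith)
      _ = x * x := Real.rpow_add hn0 _ _
      _ ≤ x * ⌈x⌉₊ := by gcongr
  have h2 : (n : ℝ) ^ (2 * m) / (⌈x⌉₊ : ℝ) ^ m ≤ x := by
    have hxm : x ^ m = (n : ℝ) ^ (2 * m - 1 : ℝ) := by
      rw [hx, ← Real.rpow_mul_natCast hn0.le]
      congr 1
      field_simp
    rw [div_le_iff₀ (by positivity)]
    calc (n : ℝ) ^ (2 * m) = (n : ℝ) ^ (1 + (2 * m - 1) : ℝ) := by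
          rw [← Real.rpow_natCast]; congr 1; push_cast; ring
      _ = n ^ (1 : ℝ) * x ^ m := by rw [Real.rpow_add hn0, hxm]
      _ ≤ x * (⌈x⌉₊ : ℝ) ^ m := by
        gcongr
        exact Real.rpow_le_rpow_of_exponent_le hn' (by linarith)
  linarith

/-- Theorem 1.3(i): if `H` is a forest with at least one edge then `f₂(n,H) = Θ(n²)`;
otherwise `f₂(n,H) = O(n^{2-ε})` for some `ε > 0`. -/
theorem stmt_0 :
    (∀ (V : Type) [Fintype V] (H : SimpleGraph V),
      H.IsAcyclic → (∃ u v, H.Adj u v) →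
      ∃ c₁ c₂ : ℝ, 0 < c₁ ∧ 0 < c₂ ∧ ∃ n₀ : ℕ, ∀ n ≥ n₀,
        c₁ * (n : ℝ) ^ 2 ≤ (repeatNumber 2 n H : ℝ) ∧
          (repeatNumber 2 n H : ℝ) ≤ c₂ * (n : ℝ) ^ 2) ∧
    (∀ (V : Type) [Fintype V] (H : SimpleGraph V),
      ¬ H.IsAcyclic →
      ∃ ε c : ℝ, 0 < ε ∧ 0 < c ∧ ∃ n₀ : ℕ, ∀ n ≥ n₀,
        (repeatNumber 2 n H : ℝ) ≤ c * (n : ℝ) ^ ((2 : ℝ) - ε)) := by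
  refine ⟨fun V _ H hH hE => ?_, fun V _ H hH => ?_⟩
  · refine ⟨1 / (4 * (8 * Fintype.card V + 1)), 1, by positivity, one_pos, 2, fun n hn =>
      ⟨le_repeatNumber hH hE hn, ?_⟩⟩
    rw [one_mul]
    exact_mod_cast repeatNumber_le_sq hE n
  · obtain ⟨m, hm, ψ, s, hψ, hs, hadj⟩ := SimpleGraph.exists_cycle_indexing hH
    have hm0 : (0 : ℝ) < m := by exact_mod_cast (by omega : 0 < m)
    exact ⟨1 / m, 4, by positivity, by norm_num, 1,
      fun n hn => repeatNumber_le_rpow hm hψ hs hadj hn⟩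
end

section
/- If H is a graph containing an odd cycle (i.e., H is non-bipartite), then for every k ≥ 2 and every n ≥ 2, f_k(n,H) ≤ n + 1. -/
open Finset

/-- The sum of `a` and `b` modulo `m`, for `a, b < m`. -/
def cyclicColoring (n m : ℕ) (a b : Fin n) : ℕ :=
  if (a : ℕ) + b < m then a + b else a + b - m

theorem isProperEdgeColoring_cyclicColoring {n m : ℕ} (h : n ≤ m) :
    IsProperEdgeColoring n (cyclicColoring n m) := by
  refine ⟨fun a b => ?_, fun a b b' _ _ hb => ?_⟩
  · simp only [cyclicColoring, add_comm]
  · have hb : (b : ℕ) ≠ b' := Fin.val_ne_of_ne hb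
    unfold cyclicColoring
    split_ifs <;> omega

theorem numColors_cyclicColoring_le {n m : ℕ} (h : n ≤ m) :
    numColors n (cyclicColoring n m) ≤ m := by
  refine (card_le_card (image_subset_iff.2 fun p _ => mem_range.2 ?_)).trans_eq (card_range m)
  unfold cyclicColoring
  split_ifs <;> omega

/-- If `m` is odd, two disjoint maps into `Fin n` which agree on the colours of the edges
of `H` under the cyclic colouring yield a bipartition of `H`: their difference modulo `m`
changes sign along every edge and never vanishes. -/
theorem colorable_two_of_cyclicColoring_eq {V : Type*} {H : SimpleGraph V} {n m : ℕ}
    (h : n ≤ m) (hm : Odd m) (x y : V → Fin n) (hxy : ∀ u, x u ≠ y u)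
    (hc : ∀ u v, H.Adj u v →
      cyclicColoring n m (x u) (x v) = cyclicColoring n m (y u) (y v)) :
    H.Colorable 2 := by
  obtain ⟨t, rfl⟩ := hm
  let d : V → ℕ := fun u =>
    if (y u : ℕ) ≤ x u then x u - y u else x u + (2 * t + 1) - y u
  refine (SimpleGraph.Coloring.mk (fun u => decide (d u ≤ t)) fun {u v} huv => ?_).colorable
  have hu : (x u : ℕ) ≠ y u := Fin.val_ne_of_ne (hxy u)
  have hv : (x v : ℕ) ≠ y v := Fin.val_ne_of_ne (hxy v)
  have hsum : d u + d v = 2 * t + 1 := by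
    have huv := hc u v huv
    simp only [d]
    unfold cyclicColoring at huv
    split_ifs at huv ⊢ <;> omega
  simp only [ne_eq, decide_eq_decide]
  omega

theorem not_hasRepeat_cyclicColoring {V : Type*} {H : SimpleGraph V} (hH : ¬ H.Colorable 2)
    {k n m : ℕ} (hk : 2 ≤ k) (h : n ≤ m) (hm : Odd m) :
    ¬ HasRepeat n k H (cyclicColoring n m) := by
  rintro ⟨φ, -, hdisj, hcol⟩
  exact hH (colorable_two_of_cyclicColoring_eq h hm (φ ⟨0, by omega⟩) (φ ⟨1, by omega⟩)
    (fun u => hdisj _ _ (by simp) u u) (hcol _ _))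

/-- If `H` is non-bipartite (contains an odd cycle), then `f_k(n,H) ≤ n + 1`. -/
theorem stmt_1 (V : Type) [Fintype V] (H : SimpleGraph V) (hH : ¬ H.Colorable 2)
    (k n : ℕ) (hk : 2 ≤ k) (hn : 2 ≤ n) :
    repeatNumber k n H ≤ n + 1 := by
  obtain ⟨m, hnm, hmn, hm⟩ : ∃ m, n ≤ m ∧ m ≤ n + 1 ∧ Odd m := by
    rcases Nat.even_or_odd n with h | h
    · exact ⟨n + 1, by omega, le_rfl, h.add_one⟩
    · exact ⟨n, le_rfl, by omega, h⟩
  have hle : repeatNumber k n H ≤ numColors n (cyclicColoring n m) :=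
    Nat.sInf_le ⟨cyclicColoring n m, isProperEdgeColoring_cyclicColoring hnm, rfl,
      not_hasRepeat_cyclicColoring hH hk hnm hm⟩
  exact hle.trans ((numColors_cyclicColoring_le hnm).trans hmn)
end

section
/- If H is a graph containing an odd cycle and n is odd, then for every k ≥ 2, f_k(n,H) ≤ n. Explicitly, the colouring of K_n on vertex set Z_n assigning edge {a,b} the colour a + b (mod n) is a proper edge-colouring with n colours in which no two distinct copies of any odd cycle are colour-isomorphic. -/
open Finset

/-- If `d` takes opposite values in `ZMod n`, `n` odd, at adjacent vertices of a graph that is not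
bipartite, then `d` vanishes somewhere. -/
lemma exists_eq_zero_of_adj_eq_neg {V : Type*} {G : SimpleGraph V} (hG : ¬ G.Colorable 2)
    {n : ℕ} (hn : Odd n) (d : V → ZMod n) (hd : ∀ u v, G.Adj u v → d u = -d v) :
    ∃ v, d v = 0 := by
  by_contra! hne
  have : NeZero n := ⟨hn.pos.ne'⟩
  refine hG ((SimpleGraph.Coloring.mk (fun v => decide (2 * (d v).val < n)) ?_ :
    G.Coloring Bool).colorable)
  intro u v huv heq
  have hval : (d u).val = n - (d v).val := by
    rw [hd u v huv, ZMod.neg_val, if_neg (hne v)]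
  have hlt := ZMod.val_lt (d v)
  obtain ⟨m, hm⟩ := hn
  rw [decide_eq_decide] at heq
  omega

/-- If `d` takes opposite values in `ZMod n`, `n` odd, at adjacent vertices of a connected graph
that is not bipartite, then `d` vanishes everywhere. -/
lemma eq_zero_of_adj_eq_neg {V : Type*} {G : SimpleGraph V} (hG : ¬ G.Colorable 2)
    (hconn : G.Preconnected) {n : ℕ} (hn : Odd n) (d : V → ZMod n)
    (hd : ∀ u v, G.Adj u v → d u = -d v) (v : V) : d v = 0 := by
  obtain ⟨w, hw⟩ := exists_eq_zero_of_adj_eq_neg hG hn d hd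
  obtain ⟨p⟩ := hconn v w
  induction p with
  | nil => exact hw
  | cons h _ ih => rw [hd _ _ h, ih hw, neg_zero]

lemma Fin.natCast_zmod_injective (n : ℕ) :
    Function.Injective (fun a : Fin n => ((a : ℕ) : ZMod n)) := by
  intro a b h
  have h' := (ZMod.natCast_eq_natCast_iff' _ _ _).1 h
  rw [Nat.mod_eq_of_lt a.isLt, Nat.mod_eq_of_lt b.isLt] at h'
  exact Fin.ext h'

lemma sub_eq_neg_sub_of_val_add_eq {n : ℕ} [NeZero n] {a b c d : ZMod n}
    (h : (a + b).val = (c + d).val) : a - c = -(b - d) := by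
  linear_combination ZMod.val_injective n h

lemma isProperEdgeColoring_val_add (n : ℕ) [NeZero n] :
    IsProperEdgeColoring n (fun a b : Fin n => (((a : ℕ) + (b : ℕ) : ZMod n)).val) := by
  refine ⟨fun a b => by simp only [add_comm], fun a b b' _ _ hbb' h => hbb' ?_⟩
  exact Fin.natCast_zmod_injective n (add_left_cancel (ZMod.val_injective n h))

lemma numColors_val_add {n : ℕ} (hn : 3 ≤ n) :
    numColors n (fun a b : Fin n => (((a : ℕ) + (b : ℕ) : ZMod n)).val) = n := by
  have : NeZero n := ⟨by omega⟩
  unfold numColors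
  convert Finset.card_range n using 2
  ext s
  simp only [Finset.mem_image, Finset.mem_filter, Finset.mem_univ, true_and, Finset.mem_range,
    Prod.exists]
  constructor
  · rintro ⟨a, b, -, rfl⟩
    exact ZMod.val_lt _
  · intro hs
    have key : ∀ a b : ℕ, a < n → b < n → a ≠ b → (a + b = s ∨ a + b = s + n) →
        ∃ a b : Fin n, a ≠ b ∧ (((a : ℕ) + (b : ℕ) : ZMod n)).val = s := by
      intro a b ha hb hab h
      refine ⟨⟨a, ha⟩, ⟨b, hb⟩, by simpa using hab, ?_⟩
      rw [← Nat.cast_add, ZMod.val_natCast]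
      rcases h with h | h
      · rw [h, Nat.mod_eq_of_lt hs]
      · rw [h, Nat.add_mod_right, Nat.mod_eq_of_lt hs]
    rcases Nat.eq_zero_or_pos s with rfl | hpos
    · exact key 1 (n - 1) (by omega) (by omega) (by omega) (by omega)
    · exact key 0 s (by omega) hs (by omega) (by omega)

lemma not_hasRepeat_val_add {V : Type*} {H : SimpleGraph V} (hH : ¬ H.Colorable 2)
    {k n : ℕ} (hk : 2 ≤ k) (hodd : Odd n) :
    ¬ HasRepeat n k H (fun a b : Fin n => (((a : ℕ) + (b : ℕ) : ZMod n)).val) := by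
  have : NeZero n := ⟨hodd.pos.ne'⟩
  rintro ⟨φ, -, hdisj, hcol⟩
  let i : Fin k := ⟨0, by omega⟩
  let j : Fin k := ⟨1, by omega⟩
  have hij : i ≠ j := by simp [i, j]
  obtain ⟨v, hv⟩ := exists_eq_zero_of_adj_eq_neg hH hodd
    (fun v => ((φ i v : ℕ) : ZMod n) - ((φ j v : ℕ) : ZMod n))
    (fun u v huv => sub_eq_neg_sub_of_val_add_eq (hcol i j u v huv))
  exact hdisj i j hij v v (Fin.natCast_zmod_injective n (sub_eq_zero.1 hv))

lemma SimpleGraph.not_colorable_two_cycleGraph {l : ℕ} (hl : 3 ≤ l) (hodd : Odd l) :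
    ¬ (SimpleGraph.cycleGraph l).Colorable 2 := by
  intro h
  have h2 := h.chromaticNumber_le
  rw [SimpleGraph.chromaticNumber_cycleGraph_of_odd l (by omega) hodd] at h2
  exact absurd h2 (by decide)

/-- If `H` contains an odd cycle and `n` is odd, then `f_k(n,H) ≤ n`.  Explicitly,
colouring the edge `{a,b}` of `K_n` by `a + b (mod n)` is a proper edge colouring
with `n` colours in which no two distinct copies of any odd cycle are colour-isomorphic. -/
theorem stmt_2 (V : Type) [Fintype V] (H : SimpleGraph V) (hH : ¬ H.Colorable 2)
    (k n : ℕ) (hk : 2 ≤ k) (hn : 2 ≤ n) (hodd : Odd n) :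
    repeatNumber k n H ≤ n ∧
    IsProperEdgeColoring n (fun a b : Fin n => (((a : ℕ) + (b : ℕ) : ZMod n)).val) ∧
    numColors n (fun a b : Fin n => (((a : ℕ) + (b : ℕ) : ZMod n)).val) = n ∧
    (∀ ℓ : ℕ, 3 ≤ ℓ → Odd ℓ →
      ∀ φ ψ : Fin ℓ → Fin n, Function.Injective φ → Function.Injective ψ →
        (∀ u v : Fin ℓ, (SimpleGraph.cycleGraph ℓ).Adj u v →
          (((φ u : ℕ) + (φ v : ℕ) : ZMod n)).val = (((ψ u : ℕ) + (ψ v : ℕ) : ZMod n)).val) →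
        φ = ψ) := by
  have : NeZero n := ⟨hodd.pos.ne'⟩
  have hn3 : 3 ≤ n := by
    obtain ⟨m, hm⟩ := hodd
    omega
  have hproper := isProperEdgeColoring_val_add n
  have hcard := numColors_val_add hn3
  refine ⟨Nat.sInf_le ⟨_, hproper, hcard, not_hasRepeat_val_add hH hk hodd⟩, hproper, hcard, ?_⟩
  intro ℓ hℓ hℓodd φ ψ _ _ hcol
  funext v
  have hv := eq_zero_of_adj_eq_neg (SimpleGraph.not_colorable_two_cycleGraph hℓ hℓodd)
    SimpleGraph.cycleGraph_preconnected hodd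
    (fun v => ((φ v : ℕ) : ZMod n) - ((ψ v : ℕ) : ZMod n))
    (fun u v huv => sub_eq_neg_sub_of_val_add_eq (hcol u v huv)) v
  exact Fin.natCast_zmod_injective n (sub_eq_zero.1 hv)
end

section
/- There exist a bipartite graph H, constants ε > 0, c > 0 and n₀ such that for all n ≥ n₀, f₂(n,H) ≥ n^{1+ε} and f₂(n,H) ≤ c·n^{2−ε}. -/
open Finset

theorem card_le_card_mul_of_fiber {α β γ : Type*} [DecidableEq β] {s : Finset α} {t : Finset β}
    {m : ℕ} (f : α → β) (g : α → γ) (u : β → Finset γ) (hf : ∀ a ∈ s, f a ∈ t)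
    (hg : ∀ a ∈ s, g a ∈ u (f a))
    (hinj : ∀ a ∈ s, ∀ a' ∈ s, f a = f a' → g a = g a' → a = a')
    (hm : ∀ b ∈ t, #(u b) ≤ m) : #s ≤ #t * m := by
  rw [mul_comm]
  refine Finset.card_le_mul_card_image_of_maps_to hf m fun b hb => ?_
  refine (Finset.card_le_card_of_injOn g ?_ ?_).trans (hm b hb)
  · intro a ha
    simp only [coe_filter, Set.mem_ofPred_eq] at ha
    exact ha.2 ▸ hg a ha.1
  · intro a ha a' ha' h
    simp only [coe_filter, Set.mem_ofPred_eq] at ha ha'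
    exact hinj a ha.1 a' ha'.1 (ha.2.trans ha'.2.symm) h

section Hexagon

variable {P : Type*} [Fintype P] (A K : P → P → Prop)

/-- A hexagon of `A` whose six vertices are pairwise not in the conflict relation `K`, where
adjacent vertices are assumed not to be in conflict. -/
def HasCleanHexagon : Prop :=
  ∃ a b c d e f, (A a b ∧ A b c ∧ A c d ∧ A d e ∧ A e f ∧ A f a) ∧
    (¬ K a c ∧ ¬ K a d ∧ ¬ K a e) ∧ (¬ K b d ∧ ¬ K b e ∧ ¬ K b f) ∧
    (¬ K c e ∧ ¬ K c f) ∧ ¬ K d f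

open Classical in
/-- The number of walks with three edges in the relation `A`. -/
noncomputable def numThreeWalks : ℕ :=
  #{w : P × P × P × P | A w.1 w.2.1 ∧ A w.2.1 w.2.2.1 ∧ A w.2.2.1 w.2.2.2}

open Classical in
theorem card_darts_pow_three_le (hA : ∀ p q, A p q → A q p) :
    #{w : P × P | A w.1 w.2} ^ 3 ≤ 32 * Fintype.card P ^ 2 * numThreeWalks A := by
  set N := Fintype.card P
  set deg : P → ℕ := fun p => #{q | A p q} with hdeg
  set e := #{w : P × P | A w.1 w.2} with he
  have hW : numThreeWalks A = ∑ w : P × P with A w.1 w.2, deg w.1 * deg w.2 := by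
    have h1 : numThreeWalks A
        = #((({w : P × P | A w.1 w.2} : Finset (P × P))).sigma
          fun w => ({q | A w.1 q} : Finset P) ×ˢ ({q | A w.2 q} : Finset P)) := by
      refine Finset.card_bij' (fun w _ => ⟨(w.2.1, w.2.2.1), (w.1, w.2.2.2)⟩)
        (fun z _ => (z.2.1, z.1.1, z.1.2, z.2.2)) ?_ ?_ ?_ ?_
      · rintro ⟨a, b, c, d⟩ h
        simp only [mem_filter, mem_univ, true_and, mem_sigma, mem_product] at h ⊢
        exact ⟨h.2.1, hA _ _ h.1, h.2.2⟩
      · rintro ⟨⟨b, c⟩, ⟨a, d⟩⟩ h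
        simp only [mem_filter, mem_univ, true_and, mem_sigma, mem_product] at h ⊢
        exact ⟨hA _ _ h.2.1, h.1, h.2.2⟩
      · intros; rfl
      · intros; rfl
    rw [h1, card_sigma]
    simp only [card_product, hdeg]
  have hbad : 4 * #{w : P × P | A w.1 w.2 ∧ 4 * N * deg w.1 < e} ≤ e := by
    by_cases hN : N = 0
    · have : IsEmpty P := Fintype.card_eq_zero_iff.mp hN
      simp
    have h1 : #{w : P × P | A w.1 w.2 ∧ 4 * N * deg w.1 < e}
        ≤ #(univ : Finset P) * (e / (4 * N)) := by
      refine card_le_card_mul_of_fiber Prod.fst Prod.snd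
        (fun p => if 4 * N * deg p < e then ({q | A p q} : Finset P) else ∅) (by simp) ?_ ?_ ?_
      · rintro ⟨a, b⟩ h
        simp only [mem_filter, mem_univ, true_and] at h
        simp [h.1, h.2]
      · rintro ⟨a, b⟩ _ ⟨a', b'⟩ _ h h'
        simp_all
      · intro b _
        split_ifs with h
        · rw [Nat.le_div_iff_mul_le (by omega), mul_comm]
          exact h.le
        · simp
    rw [card_univ] at h1
    have h2 : 4 * N * (e / (4 * N)) ≤ e := Nat.mul_div_le e (4 * N)
    calc _ ≤ 4 * (N * (e / (4 * N))) := by gcongr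
      _ ≤ e := by linarith
  have hbad' : #{w : P × P | A w.1 w.2 ∧ 4 * N * deg w.2 < e}
      = #{w : P × P | A w.1 w.2 ∧ 4 * N * deg w.1 < e} := by
    refine Finset.card_bij' (fun w _ => w.swap) (fun w _ => w.swap) ?_ ?_ ?_ ?_ <;>
      simp +contextual [hA]
  set G : Finset (P × P) := {w | A w.1 w.2 ∧ e ≤ 4 * N * deg w.1 ∧ e ≤ 4 * N * deg w.2} with hG
  have hcover : e ≤ #G + (#{w : P × P | A w.1 w.2 ∧ 4 * N * deg w.1 < e}
      + #{w : P × P | A w.1 w.2 ∧ 4 * N * deg w.2 < e}) := by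
    refine le_trans (card_le_card ?_)
      ((card_union_le _ _).trans (Nat.add_le_add_left (card_union_le _ _) _))
    intro w hw
    simp only [mem_filter, mem_univ, true_and, mem_union, hG] at hw ⊢
    by_cases h1 : 4 * N * deg w.1 < e
    · tauto
    by_cases h2 : 4 * N * deg w.2 < e
    · tauto
    exact Or.inl ⟨hw, not_lt.mp h1, not_lt.mp h2⟩
  have hGe : e ≤ 2 * #G := by omega
  have hsum : #G * (e * e) ≤ 16 * N ^ 2 * numThreeWalks A := by
    calc #G * (e * e) = ∑ _w ∈ G, e * e := by simp
      _ ≤ ∑ w ∈ G, (4 * N * deg w.1) * (4 * N * deg w.2) := by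
          refine sum_le_sum fun w hw => ?_
          simp only [hG, mem_filter] at hw
          exact Nat.mul_le_mul hw.2.2.1 hw.2.2.2
      _ ≤ ∑ w : P × P with A w.1 w.2, (4 * N * deg w.1) * (4 * N * deg w.2) := by
          refine sum_le_sum_of_subset fun w hw => ?_
          simp only [hG, mem_filter] at hw ⊢
          exact ⟨mem_univ _, hw.2.1⟩
      _ = _ := by
          rw [hW, mul_sum]
          exact sum_congr rfl fun _ _ => by ring
  calc e ^ 3 = e * (e * e) := by ring
    _ ≤ 2 * #G * (e * e) := by gcongr
    _ ≤ _ := by linarith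

open Classical in
theorem numThreeWalks_le_of_not_hasCleanHexagon {n : ℕ} (hA : ∀ p q, A p q → A q p)
    (hK : ∀ p q, K p q → K q p) (hAK : ∀ p q, A p q → ¬ K p q) (hdeg : ∀ p, #{q | A p q} ≤ n)
    (hconf : ∀ p r, #{q | A p q ∧ K q r} ≤ 4) (h6 : ¬ HasCleanHexagon A K) :
    numThreeWalks A ≤ 20 * Fintype.card P * n ^ 2 + 192 * Fintype.card P ^ 2 := by
  set N := Fintype.card P
  set codeg : P → P → ℕ := fun p q => #{r | A p r ∧ A q r} with hcodeg
  -- a large set of neighbours contains one avoiding any three prescribed vertices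
  have avoid : ∀ (s : Finset P) (p q₁ q₂ q₃ : P), (∀ r ∈ s, A p r) → 13 ≤ #s →
      ∃ r ∈ s, ¬ K r q₁ ∧ ¬ K r q₂ ∧ ¬ K r q₃ := by
    intro s p q₁ q₂ q₃ hs h13
    by_contra! hcon
    have : s ⊆ ({r | A p r ∧ K r q₁} : Finset P) ∪
        (({r | A p r ∧ K r q₂} : Finset P) ∪ ({r | A p r ∧ K r q₃} : Finset P)) := by
      intro r hr
      have := hcon r hr
      have := hs r hr
      simp only [mem_union, mem_filter, mem_univ, true_and]
      tauto
    have h := (card_le_card this).trans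
      ((card_union_le _ _).trans (Nat.add_le_add_left (card_union_le _ _) _))
    have := hconf p q₁
    have := hconf p q₂
    have := hconf p q₃
    omega
  have heavy : ∀ x b, A x b → #{y | A b y ∧ ¬ K x y ∧ 13 ≤ codeg x y} ≤ 4 := by
    intro x b hxb
    by_contra! hlt
    obtain ⟨y, hy⟩ : ({y | A b y ∧ ¬ K x y ∧ 13 ≤ codeg x y} : Finset P).Nonempty :=
      card_pos.mp (by omega)
    simp only [mem_filter, mem_univ, true_and] at hy
    obtain ⟨y', hy', hyy⟩ : ∃ y', (A b y' ∧ ¬ K x y' ∧ 13 ≤ codeg x y') ∧ ¬ K y' y := by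
      by_contra! hcon
      have := card_le_card (show ({y | A b y ∧ ¬ K x y ∧ 13 ≤ codeg x y} : Finset P) ⊆
        ({y' | A b y' ∧ K y' y} : Finset P) from fun z hz => by
          simp only [mem_filter, mem_univ, true_and] at hz ⊢
          exact ⟨hz.1, hcon z hz⟩)
      have := hconf b y
      omega
    obtain ⟨a, ha, hab, hay', -⟩ := avoid {r | A x r ∧ A y r} x b y' b
      (by simp +contextual) hy.2.2
    obtain ⟨c, hc, hcb, hca, hcy⟩ := avoid {r | A x r ∧ A y' r} x b a y
      (by simp +contextual) hy'.2.2
    simp only [mem_filter, mem_univ, true_and] at ha hc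
    refine h6 ⟨x, a, y, b, y', c, ⟨ha.1, hA _ _ ha.2, hA _ _ hy.1, hy'.1, hc.2, hA _ _ hc.1⟩,
      ⟨hy.2.1, hAK _ _ hxb, hy'.2.1⟩, ⟨hab, hay', fun h => hca (hK _ _ h)⟩,
      ⟨fun h => hyy (hK _ _ h), fun h => hcy (hK _ _ h)⟩, fun h => hcb (hK _ _ h)⟩
  have two : #{w : P × P | A w.1 w.2} ≤ N * n := by
    refine card_le_card_mul_of_fiber (t := univ) Prod.fst Prod.snd (fun p => {q | A p q})
      (by simp) (by simp) (fun a _ a' _ => Prod.ext) fun b _ => hdeg b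
  have three : #{w : P × P × P | A w.1 w.2.1 ∧ A w.2.1 w.2.2} ≤ N * n * n := by
    refine le_trans (card_le_card_mul_of_fiber (t := {w : P × P | A w.1 w.2}) (m := n)
      (fun w => (w.1, w.2.1)) (fun w => w.2.2) (fun p => {q | A p.2 q})
      ?_ ?_ ?_ fun b _ => hdeg b.2) (Nat.mul_le_mul_right n two)
    · simp +contextual
    · simp +contextual
    · rintro ⟨a, b, c⟩ _ ⟨a', b', c'⟩ _ h h'
      simp_all
  set light : P × P × P × P → Prop := fun w =>
    (¬ K w.1 w.2.2.1 ∧ ¬ K w.2.1 w.2.2.2 ∧ ¬ K w.1 w.2.2.2) ∧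
      codeg w.1 w.2.2.1 ≤ 12 ∧ codeg w.2.1 w.2.2.2 ≤ 12 with hlight
  set W : Finset (P × P × P × P) :=
    {w | A w.1 w.2.1 ∧ A w.2.1 w.2.2.1 ∧ A w.2.2.1 w.2.2.2} with hWdef
  have b1 : #{w ∈ W | K w.1 w.2.2.1} ≤ N * n * n * 4 := by
    refine le_trans (card_le_card_mul_of_fiber
      (t := {w : P × P × P | A w.1 w.2.1 ∧ A w.2.1 w.2.2}) (m := 4)
      (fun w => w.2) (fun w => w.1) (fun p => {q | A p.1 q ∧ K q p.2.1})
      ?_ ?_ ?_ fun b _ => hconf b.1 b.2.1) (Nat.mul_le_mul_right 4 three)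
    · simp +contextual [hWdef]
    · rintro ⟨a, b, c, d⟩ h
      simp only [hWdef, mem_filter, mem_univ, true_and] at h ⊢
      exact ⟨hA _ _ h.1.1, h.2⟩
    · rintro ⟨a, b, c, d⟩ _ ⟨a', b', c', d'⟩ _ h h'
      simp_all
  have b23 : ∀ g : P × P × P → P, #{w ∈ W | K w.2.2.2 (g (w.1, w.2.1, w.2.2.1))}
      ≤ N * n * n * 4 := by
    intro g
    refine le_trans (card_le_card_mul_of_fiber
      (t := {w : P × P × P | A w.1 w.2.1 ∧ A w.2.1 w.2.2}) (m := 4)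
      (fun w => (w.1, w.2.1, w.2.2.1)) (fun w => w.2.2.2)
      (fun p => {q | A p.2.2 q ∧ K q (g p)})
      ?_ ?_ ?_ fun b _ => hconf b.2.2 (g b)) (Nat.mul_le_mul_right 4 three)
    · simp +contextual [hWdef]
    · rintro ⟨a, b, c, d⟩ h
      simp only [hWdef, mem_filter, mem_univ, true_and] at h ⊢
      exact ⟨h.1.2.2, h.2⟩
    · rintro ⟨a, b, c, d⟩ _ ⟨a', b', c', d'⟩ _ h h'
      simp_all
  have heavyWalks : #{w : P × P × P | A w.1 w.2.1 ∧ A w.2.1 w.2.2 ∧ ¬ K w.1 w.2.2 ∧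
      13 ≤ codeg w.1 w.2.2} ≤ N * n * 4 := by
    refine le_trans (card_le_card_mul_of_fiber (t := {w : P × P | A w.1 w.2}) (m := 4)
      (fun w => (w.1, w.2.1)) (fun w => w.2.2)
      (fun p => {y | A p.2 y ∧ ¬ K p.1 y ∧ 13 ≤ codeg p.1 y})
      ?_ ?_ ?_ fun b hb => heavy b.1 b.2 (by simpa using hb)) (Nat.mul_le_mul_right 4 two)
    · simp +contextual
    · simp +contextual
    · rintro ⟨a, b, c⟩ _ ⟨a', b', c'⟩ _ h h'
      simp_all
  have b4 : #{w ∈ W | ¬ K w.1 w.2.2.1 ∧ 13 ≤ codeg w.1 w.2.2.1} ≤ N * n * 4 * n := by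
    refine le_trans (card_le_card_mul_of_fiber (m := n)
      (fun w => (w.1, w.2.1, w.2.2.1)) (fun w => w.2.2.2) (fun p => {q | A p.2.2 q})
      ?_ ?_ ?_ fun b _ => hdeg b.2.2) (Nat.mul_le_mul_right n heavyWalks)
    · rintro ⟨a, b, c, d⟩ h
      simp only [hWdef, mem_filter, mem_univ, true_and] at h ⊢
      tauto
    · simp +contextual [hWdef]
    · rintro ⟨a, b, c, d⟩ _ ⟨a', b', c', d'⟩ _ h h'
      simp_all
  have b5 : #{w ∈ W | ¬ K w.2.1 w.2.2.2 ∧ 13 ≤ codeg w.2.1 w.2.2.2} ≤ N * n * 4 * n := by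
    refine le_trans (card_le_card_mul_of_fiber (m := n)
      (fun w => w.2) (fun w => w.1) (fun p => {q | A p.1 q})
      ?_ ?_ ?_ fun b _ => hdeg b.1) (Nat.mul_le_mul_right n heavyWalks)
    · rintro ⟨a, b, c, d⟩ h
      simp only [hWdef, mem_filter, mem_univ, true_and] at h ⊢
      tauto
    · rintro ⟨a, b, c, d⟩ h
      simp only [hWdef, mem_filter, mem_univ, true_and] at h ⊢
      exact hA _ _ h.1.1
    · rintro ⟨a, b, c, d⟩ _ ⟨a', b', c', d'⟩ _ h h'
      simp_all
  have detour : ∀ x y u v : P, #{z : P × P | A x z.1 ∧ (K z.1 u ∨ K z.1 v) ∧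
      A z.1 z.2 ∧ A y z.2 ∧ codeg z.1 y ≤ 12} ≤ 8 * 12 := by
    intro x y u v
    have h8 : #{q | A x q ∧ (K q u ∨ K q v)} ≤ 8 := by
      have := hconf x u
      have := hconf x v
      refine le_trans (card_le_card (t := ({q | A x q ∧ K q u} : Finset P) ∪
        ({q | A x q ∧ K q v} : Finset P)) ?_) ((card_union_le _ _).trans (by omega))
      intro q hq
      simp only [mem_filter, mem_univ, true_and, mem_union] at hq ⊢
      tauto
    refine le_trans (card_le_card_mul_of_fiber (t := {q | A x q ∧ (K q u ∨ K q v)})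
      (m := 12) Prod.fst Prod.snd
      (fun p => if codeg p y ≤ 12 then ({q | A p q ∧ A y q} : Finset P) else ∅)
      ?_ ?_ (fun a _ a' _ => Prod.ext) ?_) (Nat.mul_le_mul_right 12 h8)
    · simp +contextual
    · rintro ⟨a, b⟩ h
      simp only [mem_filter, mem_univ, true_and] at h ⊢
      simp [h]
    · intro b _
      split_ifs with h
      · exact h
      · simp
  have b6 : #{w ∈ W | light w} ≤ N * N * 192 := by
    refine le_trans (Finset.card_le_mul_card_image_of_maps_to
      (f := fun w => (w.1, w.2.2.2)) (t := univ) (by simp) 192 ?_)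
      (by simp [N, mul_comm])
    rintro ⟨x, y⟩ -
    rcases Finset.eq_empty_or_nonempty
      ({w ∈ ({w ∈ W | light w} : Finset _) | (w.1, w.2.2.2) = (x, y)}) with hemp | hne
    · rw [hemp]; simp
    obtain ⟨⟨x', a, b, y'⟩, hP⟩ := hne
    simp only [hWdef, hlight, mem_filter, mem_univ, true_and, Prod.mk.injEq] at hP
    obtain ⟨⟨⟨hxa, hab, hby⟩, ⟨hxb, hay, hxy⟩, -, -⟩, rfl, rfl⟩ := hP
    refine le_trans (card_le_card_of_injOn (fun w => (w.2.1, w.2.2.1))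
      (t := ({z : P × P | A x' z.1 ∧ (K z.1 a ∨ K z.1 b) ∧
        A z.1 z.2 ∧ A y' z.2 ∧ codeg z.1 y' ≤ 12} : Finset _) ∪
        (({z : P × P | A y' z.1 ∧ (K z.1 a ∨ K z.1 b) ∧
        A z.1 z.2 ∧ A x' z.2 ∧ codeg z.1 x' ≤ 12} : Finset _).image Prod.swap)) ?_ ?_) ?_
    · rintro ⟨x, a', b', y⟩ h
      simp only [hWdef, hlight, coe_filter, mem_filter, mem_univ, true_and, Prod.mk.injEq,
        Set.mem_ofPred_eq] at h
      obtain ⟨⟨⟨hxa', hab', hby'⟩, ⟨hxb', hay', -⟩, h1, h2⟩, rfl, rfl⟩ := h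
      simp only [coe_union, coe_image, coe_filter, mem_univ, true_and, Set.mem_union,
        Set.mem_ofPred_eq, Set.mem_image]
      by_cases hc : K a' a ∨ K a' b
      · exact Or.inl ⟨hxa', hc, hab', hA _ _ hby', h2⟩
      by_cases hc' : K b' a ∨ K b' b
      · refine Or.inr ⟨(b', a'), ⟨hA _ _ hby', hc', hA _ _ hab', hxa', ?_⟩, rfl⟩
        rw [show codeg b' x = codeg x b' by simp only [hcodeg, and_comm]]
        exact h1
      push Not at hc hc'
      exact absurd ⟨x, a, b, y, b', a', ⟨hxa, hab, hby, hA _ _ hby', hA _ _ hab', hA _ _ hxa'⟩,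
        ⟨hxb, hxy, hxb'⟩, ⟨hay, fun h => hc'.1 (hK _ _ h), fun h => hc.1 (hK _ _ h)⟩,
        ⟨fun h => hc'.2 (hK _ _ h), fun h => hc.2 (hK _ _ h)⟩, fun h => hay' (hK _ _ h)⟩ h6
    · rintro ⟨x, a', b', y⟩ h ⟨x₂, a₂, b₂, y₂⟩ h' heq
      simp only [coe_filter, mem_filter, Prod.mk.injEq, Set.mem_ofPred_eq] at h h' heq
      simp_all
    · have h1 := detour x' y' a b
      have h2 := (card_image_le (f := Prod.swap) (s := ({z : P × P | A y' z.1 ∧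
        (K z.1 a ∨ K z.1 b) ∧ A z.1 z.2 ∧ A x' z.2 ∧ codeg z.1 x' ≤ 12} : Finset _))).trans
        (detour y' x' a b)
      exact (card_union_le _ _).trans (by omega)
  have hcover : #W ≤ #{w ∈ W | light w} + (#{w ∈ W | K w.1 w.2.2.1} +
      (#{w ∈ W | K w.2.2.2 w.2.1} + (#{w ∈ W | K w.2.2.2 w.1} +
      (#{w ∈ W | ¬ K w.1 w.2.2.1 ∧ 13 ≤ codeg w.1 w.2.2.1} +
        #{w ∈ W | ¬ K w.2.1 w.2.2.2 ∧ 13 ≤ codeg w.2.1 w.2.2.2})))) := by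
    refine le_trans (card_le_card ?_) ((card_union_le _ _).trans (Nat.add_le_add_left
      ((card_union_le _ _).trans (Nat.add_le_add_left ((card_union_le _ _).trans
      (Nat.add_le_add_left ((card_union_le _ _).trans (Nat.add_le_add_left
      (card_union_le _ _) _)) _)) _)) _))
    intro w hw
    by_contra hcon
    simp only [mem_union, mem_filter, hw, true_and, not_or, not_and, not_le] at hcon
    obtain ⟨h0, h1, h2, h3, h4, h5⟩ := hcon
    have h2' := mt (hK w.2.1 w.2.2.2) h2
    exact h0 ⟨⟨h1, h2', mt (hK w.1 w.2.2.2) h3⟩, Nat.le_of_lt_succ (h4 h1),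
      Nat.le_of_lt_succ (h5 h2')⟩
  have b2 := b23 fun p => p.2.1
  have b3 := b23 fun p => p.1
  simp only at b2 b3
  change #W ≤ _
  nlinarith [hcover, b1, b2, b3, b4, b5, b6]

end Hexagon

theorem hasRepeat_of_hasCleanHexagon {n : ℕ} {c : Fin n → Fin n → ℕ}
    {A K : Fin n × Fin n → Fin n × Fin n → Prop}
    (hA : ∀ p q, A p q → p.1 ≠ p.2 ∧ ¬ K p q ∧ c p.1 q.1 = c p.2 q.2)
    (hsymm : ∀ p q, A p q → A q p)
    (hK : ∀ p q, ¬ K p q → p.1 ≠ q.1 ∧ p.1 ≠ q.2 ∧ p.2 ≠ q.1 ∧ p.2 ≠ q.2)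
    (h : HasCleanHexagon A K) : HasRepeat n 2 (SimpleGraph.cycleGraph 6) c := by
  obtain ⟨x₀, x₁, x₂, x₃, x₄, x₅, ⟨h01, h12, h23, h34, h45, h50⟩, ⟨h02, h03, h04⟩,
    ⟨h13, h14, h15⟩, ⟨h24, h25⟩, h35⟩ := h
  set x : Fin 6 → Fin n × Fin n := ![x₀, x₁, x₂, x₃, x₄, x₅] with hx
  have hadj : ∀ i, A (x i) (x (i + 1)) := by
    intro i
    fin_cases i <;> assumption
  have hlt : ∀ i j, i < j → (x i).1 ≠ (x j).1 ∧ (x i).1 ≠ (x j).2 ∧ (x i).2 ≠ (x j).1 ∧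
      (x i).2 ≠ (x j).2 := by
    have h01' := (hA _ _ h01).2.1
    have h12' := (hA _ _ h12).2.1
    have h23' := (hA _ _ h23).2.1
    have h34' := (hA _ _ h34).2.1
    have h45' := (hA _ _ h45).2.1
    have h05' := (hA _ _ (hsymm _ _ h50)).2.1
    intro i j hij
    apply hK
    fin_cases i <;> fin_cases j <;> first | assumption | exact absurd hij (by decide)
  have hne : ∀ i j, i ≠ j → (x i).1 ≠ (x j).1 ∧ (x i).1 ≠ (x j).2 ∧ (x i).2 ≠ (x j).1 ∧
      (x i).2 ≠ (x j).2 := by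
    intro i j hij
    rcases lt_or_gt_of_ne hij with h | h
    · exact hlt i j h
    · obtain ⟨a, b, c, d⟩ := hlt j i h
      exact ⟨a.symm, c.symm, b.symm, d.symm⟩
  have hcol : ∀ u v, (SimpleGraph.cycleGraph 6).Adj u v →
      c (x u).1 (x v).1 = c (x u).2 (x v).2 := by
    intro u v huv
    rw [SimpleGraph.cycleGraph_adj] at huv
    rcases huv with h | h
    · obtain rfl : u = v + 1 := by rw [← h]; abel
      exact (hA _ _ (hsymm _ _ (hadj v))).2.2
    · obtain rfl : v = u + 1 := by rw [← h]; abel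
      exact (hA _ _ (hadj u)).2.2
  refine ⟨![fun i => (x i).1, fun i => (x i).2], ?_, ?_, ?_⟩
  · intro i
    fin_cases i <;> intro u v huv <;> by_contra hcon
    · exact (hne u v hcon).1 huv
    · exact (hne u v hcon).2.2.2 huv
  · have key : ∀ u v, (x u).1 ≠ (x v).2 := by
      intro u v
      by_cases huv : u = v
      · subst huv
        exact (hA _ _ (hadj u)).1
      · exact (hne u v huv).2.1
    intro i j hij u v
    fin_cases i <;> fin_cases j
    · exact absurd rfl hij
    · exact key u v
    · exact (key v u).symm
    · exact absurd rfl hij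
  · intro i j u v huv
    fin_cases i <;> fin_cases j
    · rfl
    · exact hcol u v huv
    · exact (hcol u v huv).symm
    · rfl

theorem card_darts_le_of_not_hasRepeat {n : ℕ} {c : Fin n → Fin n → ℕ}
    (hc : IsProperEdgeColoring n c) (h : ¬ HasRepeat n 2 (SimpleGraph.cycleGraph 6) c) :
    #{w : (Fin n × Fin n) × (Fin n × Fin n) | w.1.1 ≠ w.1.2 ∧ w.2.1 ≠ w.2.2 ∧
      (w.1.1 ≠ w.2.1 ∧ w.1.1 ≠ w.2.2 ∧ w.1.2 ≠ w.2.1 ∧ w.1.2 ≠ w.2.2) ∧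
      c w.1.1 w.2.1 = c w.1.2 w.2.2} ^ 3 ≤ 6784 * n ^ 8 := by
  classical
  set K : Fin n × Fin n → Fin n × Fin n → Prop := fun p q =>
    p.1 = q.1 ∨ p.1 = q.2 ∨ p.2 = q.1 ∨ p.2 = q.2 with hK
  set A : Fin n × Fin n → Fin n × Fin n → Prop := fun p q =>
    p.1 ≠ p.2 ∧ q.1 ≠ q.2 ∧ (p.1 ≠ q.1 ∧ p.1 ≠ q.2 ∧ p.2 ≠ q.1 ∧ p.2 ≠ q.2) ∧
      c p.1 q.1 = c p.2 q.2 with hA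
  have hAs : ∀ p q, A p q → A q p := by
    rintro p q ⟨h1, h2, ⟨h3, h4, h5, h6⟩, h7⟩
    exact ⟨h2, h1, ⟨h3.symm, h5.symm, h4.symm, h6.symm⟩, by rw [hc.1, h7, hc.1]⟩
  have hKs : ∀ p q, K p q → K q p := by
    intro p q
    simp only [hK, eq_comm]
    tauto
  have hAK : ∀ p q, A p q → ¬ K p q := by
    rintro p q ⟨-, -, ⟨h1, h2, h3, h4⟩, -⟩
    simp [hK, h1, h2, h3, h4]
  have inj1 : ∀ p q q', A p q → A p q' → q.1 = q'.1 → q = q' := by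
    rintro p q q' ⟨-, -, h, hq⟩ ⟨-, -, h', hq'⟩ h1
    refine Prod.ext h1 ?_
    by_contra hcon
    exact hc.2 p.2 q.2 q'.2 h.2.2.2 h'.2.2.2 hcon (by rw [← hq, ← hq', h1])
  have inj2 : ∀ p q q', A p q → A p q' → q.2 = q'.2 → q = q' := by
    rintro p q q' ⟨-, -, h, hq⟩ ⟨-, -, h', hq'⟩ h1
    refine Prod.ext ?_ h1
    by_contra hcon
    exact hc.2 p.1 q.1 q'.1 h.1 h'.1 hcon (by rw [hq, hq', h1])
  have hdeg : ∀ p, #{q | A p q} ≤ n := by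
    intro p
    have := card_le_card_of_injOn (s := ({q | A p q} : Finset _)) (t := (univ : Finset (Fin n)))
      Prod.fst (by simp) (fun q hq q' hq' => inj1 p q q' (by simpa using hq) (by simpa using hq'))
    simpa using this
  have hconf : ∀ p r, #{q | A p q ∧ K q r} ≤ 4 := by
    intro p r
    have hone : ∀ a, #{q | A p q ∧ q.1 = a} ≤ 1 := fun a => card_le_one.mpr (by
      simp only [mem_filter, mem_univ, true_and]
      exact fun q hq q' hq' => inj1 p q q' hq.1 hq'.1 (hq.2.trans hq'.2.symm))
    have htwo : ∀ a, #{q | A p q ∧ q.2 = a} ≤ 1 := fun a => card_le_one.mpr (by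
      simp only [mem_filter, mem_univ, true_and]
      exact fun q hq q' hq' => inj2 p q q' hq.1 hq'.1 (hq.2.trans hq'.2.symm))
    have h1 := hone r.1
    have h2 := hone r.2
    have h3 := htwo r.1
    have h4 := htwo r.2
    refine le_trans (card_le_card (t := ({q | A p q ∧ q.1 = r.1} : Finset _) ∪
      (({q | A p q ∧ q.1 = r.2} : Finset _) ∪ (({q | A p q ∧ q.2 = r.1} : Finset _) ∪
      ({q | A p q ∧ q.2 = r.2} : Finset _)))) ?_)
      ((card_union_le _ _).trans ((Nat.add_le_add_left ((card_union_le _ _).trans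
      (Nat.add_le_add_left (card_union_le _ _) _)) _).trans (by omega)))
    intro q hq
    simp only [mem_filter, mem_univ, true_and, mem_union, hK] at hq ⊢
    tauto
  have h6 : ¬ HasCleanHexagon A K := fun h6 => h (hasRepeat_of_hasCleanHexagon
    (fun p q hpq => ⟨hpq.1, hAK p q hpq, hpq.2.2.2⟩) hAs
    (fun p q hpq => by simpa [hK] using hpq) h6)
  have h1 := card_darts_pow_three_le A hAs
  have h2 := numThreeWalks_le_of_not_hasCleanHexagon A K hAs hKs hAK
    (fun p => by convert hdeg p) (fun p r => by convert hconf p r) h6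
  have hN : Fintype.card (Fin n × Fin n) = n ^ 2 := by simp [sq]
  rw [hN] at h1 h2
  refine le_of_eq_of_le ?_ ((h1.trans (Nat.mul_le_mul_left _ h2)).trans_eq (by ring))
  congr!

theorem sq_le_numColors_mul {n : ℕ} {c : Fin n → Fin n → ℕ} (hc : IsProperEdgeColoring n c) :
    (n * (n - 1)) ^ 2 ≤ numColors n c *
      (#{w : (Fin n × Fin n) × (Fin n × Fin n) | w.1.1 ≠ w.1.2 ∧ w.2.1 ≠ w.2.2 ∧
      (w.1.1 ≠ w.2.1 ∧ w.1.1 ≠ w.2.2 ∧ w.1.2 ≠ w.2.1 ∧ w.1.2 ≠ w.2.2) ∧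
      c w.1.1 w.2.1 = c w.1.2 w.2.2} + 2 * n ^ 2) := by
  classical
  set E : Finset (Fin n × Fin n) := univ.filter fun p => p.1 ≠ p.2 with hE
  have hEcard : #E = n * (n - 1) := by
    have : E = offDiag (univ : Finset (Fin n)) := by ext; simp [hE]
    rw [this, offDiag_card]
    simp [Nat.mul_sub]
  set f : Fin n × Fin n → ℕ := fun p => c p.1 p.2 with hf
  have h1 : #E = ∑ k ∈ E.image f, #{p ∈ E | f p = k} :=
    card_eq_sum_card_image f E
  have h2 : (#E) ^ 2 ≤ #(E.image f) * ∑ k ∈ E.image f, #{p ∈ E | f p = k} ^ 2 := by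
    conv_lhs => rw [h1]
    exact sq_sum_le_card_mul_sum_sq
  set S : Finset ((Fin n × Fin n) × (Fin n × Fin n)) := {w ∈ E ×ˢ E | f w.1 = f w.2} with hS
  have h3 : ∑ k ∈ E.image f, #{p ∈ E | f p = k} ^ 2 = #S := by
    have hmaps : ∀ w ∈ S, f w.1 ∈ E.image f := fun w hw => by
      simp only [hS, mem_filter, mem_product] at hw
      exact mem_image_of_mem f hw.1.1
    rw [card_eq_sum_card_fiberwise hmaps]
    refine sum_congr rfl fun k _ => ?_
    rw [sq, ← card_product]
    congr 1
    ext w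
    simp only [hS, mem_filter, mem_product]
    constructor
    · rintro ⟨⟨a, b⟩, a', b'⟩
      exact ⟨⟨⟨a, a'⟩, b.trans b'.symm⟩, b⟩
    · rintro ⟨⟨⟨a, b⟩, a'⟩, b'⟩
      exact ⟨⟨a, b'⟩, b, a'.symm.trans b'⟩
  have h4 : #S ≤ #{w : (Fin n × Fin n) × (Fin n × Fin n) | w.1.1 ≠ w.1.2 ∧ w.2.1 ≠ w.2.2 ∧
      (w.1.1 ≠ w.2.1 ∧ w.1.1 ≠ w.2.2 ∧ w.1.2 ≠ w.2.1 ∧ w.1.2 ≠ w.2.2) ∧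
      c w.1.1 w.2.1 = c w.1.2 w.2.2} + 2 * n ^ 2 := by
    have hs : S ⊆ (({w : (Fin n × Fin n) × (Fin n × Fin n) | w.1.1 ≠ w.1.2 ∧ w.2.1 ≠ w.2.2 ∧
      (w.1.1 ≠ w.2.1 ∧ w.1.1 ≠ w.2.2 ∧ w.1.2 ≠ w.2.1 ∧ w.1.2 ≠ w.2.2) ∧
      c w.1.1 w.2.1 = c w.1.2 w.2.2} : Finset _).image
        fun w => ((w.1.1, w.2.1), (w.1.2, w.2.2))) ∪
        ((univ : Finset (Fin n × Fin n)).image (fun p => (p, p)) ∪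
          (univ : Finset (Fin n × Fin n)).image (fun p => (p, p.swap))) := by
      rintro ⟨⟨a, a'⟩, b, b'⟩ hw
      simp only [hS, hE, hf, mem_filter, mem_product, mem_univ, true_and] at hw
      obtain ⟨⟨haa, hbb⟩, hcol⟩ := hw
      simp only [mem_union, mem_image, mem_filter, mem_univ, true_and, Prod.mk.injEq,
        Prod.exists, Prod.swap_prod_mk]
      have key : ∀ x y z, x ≠ y → x ≠ z → c x y = c x z → y = z := fun x y z h1 h2 h3 => by
        by_contra h4
        exact hc.2 x y z h1 h2 h4 h3
      by_cases e1 : a = b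
      · subst e1
        have := key _ _ _ haa hbb hcol
        exact Or.inr (Or.inl ⟨a, a', by simp [this]⟩)
      by_cases e2 : a' = b'
      · subst e2
        have := key _ _ _ haa.symm hbb.symm (by rw [hc.1, hcol, hc.1])
        exact absurd this e1
      by_cases e3 : a = b'
      · subst e3
        have := key _ _ _ haa hbb.symm (by rw [hcol, hc.1])
        exact Or.inr (Or.inr ⟨a, a', by simp [this]⟩)
      by_cases e4 : a' = b
      · subst e4
        have := key _ _ _ haa.symm hbb (by rw [hc.1, hcol])
        exact absurd this e3
      exact Or.inl ⟨a, b, a', b', ⟨e1, e2, ⟨haa, e3, Ne.symm e4, hbb⟩, hcol⟩, by simp⟩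
    refine (card_le_card hs).trans ((card_union_le _ _).trans (add_le_add card_image_le
      ((card_union_le _ _).trans ((add_le_add card_image_le card_image_le).trans ?_))))
    simp only [card_univ, Fintype.card_prod, Fintype.card_fin]
    nlinarith
  rw [← hEcard]
  refine h2.trans ?_
  rw [h3]
  exact Nat.mul_le_mul_left _ h4

theorem rpow_le_numColors {n : ℕ} (hn : 4000000000000 ≤ n) {c : Fin n → Fin n → ℕ}
    (hc : IsProperEdgeColoring n c) (h : ¬ HasRepeat n 2 (SimpleGraph.cycleGraph 6) c) :
    (n : ℝ) ^ ((1 : ℝ) + 1 / 6) ≤ numColors n c := by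
  have h1 := card_darts_le_of_not_hasRepeat hc h
  have h2 := sq_le_numColors_mul hc
  generalize #{w : (Fin n × Fin n) × (Fin n × Fin n) | w.1.1 ≠ w.1.2 ∧ w.2.1 ≠ w.2.2 ∧
      (w.1.1 ≠ w.2.1 ∧ w.1.1 ≠ w.2.2 ∧ w.1.2 ≠ w.2.1 ∧ w.1.2 ≠ w.2.2) ∧
      c w.1.1 w.2.1 = c w.1.2 w.2.2} = e at h1 h2
  have hsub : ((n - 1 : ℕ) : ℝ) = n - 1 := by
    rw [Nat.cast_sub (by omega)]; simp
  have h1' : (e : ℝ) ^ 3 ≤ 6784 * (n : ℝ) ^ 8 := by exact_mod_cast h1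
  have h2' : ((n : ℝ) * (n - 1)) ^ 2 ≤ numColors n c * (e + 2 * (n : ℝ) ^ 2) := by
    rw [← hsub]; exact_mod_cast h2
  set C : ℝ := (numColors n c : ℝ)
  have hC : 0 ≤ C := Nat.cast_nonneg _
  have hx : (4000000000000 : ℝ) ≤ n := by exact_mod_cast hn
  set x : ℝ := (n : ℝ)
  have hx0 : 0 < x := by linarith
  have he : (0 : ℝ) ≤ e := Nat.cast_nonneg _
  have hX : ((e : ℝ) + 2 * x ^ 2) ^ 3 ≤ 27168 * x ^ 8 := by
    have a1 : ((e : ℝ) + 2 * x ^ 2) ^ 3 ≤ 4 * ((e : ℝ) ^ 3 + (2 * x ^ 2) ^ 3) := by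
      have hy : 0 ≤ 2 * x ^ 2 := by positivity
      generalize 2 * x ^ 2 = y at hy
      nlinarith [mul_nonneg (add_nonneg he hy) (sq_nonneg ((e : ℝ) - y))]
    have a2 : x ^ 6 ≤ x ^ 8 := pow_le_pow_right₀ (by linarith) (by norm_num)
    nlinarith
  have h3 : (x ^ 4 / 4) ^ 3 ≤ C ^ 3 * (27168 * x ^ 8) := by
    calc (x ^ 4 / 4) ^ 3 ≤ ((x * (x - 1)) ^ 2) ^ 3 := by
          gcongr
          nlinarith [mul_nonneg (sq_nonneg x) (show 0 ≤ (x - 1) ^ 2 - x ^ 2 / 4 by nlinarith)]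
      _ ≤ (C * (e + 2 * x ^ 2)) ^ 3 := by gcongr
      _ = C ^ 3 * (e + 2 * x ^ 2) ^ 3 := by ring
      _ ≤ _ := by gcongr
  have h4 : x ^ 4 ≤ 1738752 * C ^ 3 := by
    have : x ^ 8 * x ^ 4 ≤ x ^ 8 * (1738752 * C ^ 3) := by nlinarith
    exact le_of_mul_le_mul_left this (by positivity)
  have hs : (1738752 : ℝ) ≤ x ^ ((1 : ℝ) / 2) := by
    rw [← Real.sqrt_eq_rpow]
    apply Real.le_sqrt_of_sq_le
    linarith
  have h5 : (x ^ ((1 : ℝ) + 1 / 6)) ^ 3 ≤ C ^ 3 := by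
    have e1 : (x ^ ((1 : ℝ) + 1 / 6)) ^ 3 = x ^ ((7 : ℝ) / 2) := by
      rw [← Real.rpow_natCast, ← Real.rpow_mul hx0.le]; norm_num
    have e2 : x ^ 4 = x ^ ((1 : ℝ) / 2) * x ^ ((7 : ℝ) / 2) := by
      rw [← Real.rpow_add hx0, ← Real.rpow_natCast]; norm_num
    rw [e1]
    have hpos : 0 ≤ x ^ ((7 : ℝ) / 2) := by positivity
    nlinarith [mul_le_mul_of_nonneg_right hs hpos]
  exact le_of_pow_le_pow_left₀ (by norm_num) hC h5

theorem card_eq_on_pairs_mul_le {E ι : Type*} [Fintype E] [DecidableEq E] [Fintype ι] (D : ℕ)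
    (a b : ι → E) (hb : Function.Injective b) (hab : ∀ i j, a i ≠ b j) :
    #{f : E → Fin D | ∀ i, f (a i) = f (b i)} * D ^ Fintype.card ι ≤ D ^ Fintype.card E := by
  classical
  have h1 : #{f : E → Fin D | ∀ i, f (a i) = f (b i)} ≤
      #(univ : Finset ({e : E // e ∉ univ.image b} → Fin D)) := by
    refine card_le_card_of_injOn (fun f e => f e.1) (by simp) ?_
    intro f hf g hg hfg
    simp only [coe_filter, mem_univ, true_and, Set.mem_ofPred_eq] at hf hg
    have hout : ∀ e, e ∉ univ.image b → f e = g e := fun e he => congrFun hfg ⟨e, he⟩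
    funext e
    by_cases he : e ∈ univ.image b
    · obtain ⟨i, -, rfl⟩ := mem_image.mp he
      rw [← hf, ← hg]
      exact hout _ (by simpa using fun j h => hab i j h.symm)
    · exact hout e he
  have h2 : Fintype.card {e : E // e ∉ univ.image b} + Fintype.card ι = Fintype.card E := by
    rw [Fintype.card_of_subtype (univ.image b)ᶜ (by simp), card_compl,
      card_image_of_injective _ hb, card_univ]
    exact Nat.sub_add_cancel (Fintype.card_le_of_injective b hb)
  calc _ ≤ D ^ Fintype.card {e : E // e ∉ univ.image b} * D ^ Fintype.card ι := by
        refine Nat.mul_le_mul_right _ (h1.trans ?_)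
        simp
    _ = _ := by rw [← pow_add, h2]

/-- The pairs of distinct edges at a common vertex receiving the same colour under `f`. -/
def sameColorCherries (n D : ℕ) (f : Sym2 (Fin n) → Fin D) : Finset (Fin n × Fin n × Fin n) :=
  {t | (t.1 ≠ t.2.1 ∧ t.1 ≠ t.2.2 ∧ t.2.1 ≠ t.2.2) ∧ f s(t.1, t.2.1) = f s(t.1, t.2.2)}

open Classical in
/-- The pairs of disjoint hexagons that are colour-isomorphic under `f`. -/
noncomputable def repeatedHexagons (n D : ℕ) (f : Sym2 (Fin n) → Fin D) :
    Finset (Fin 2 → Fin 6 → Fin n) :=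
  {φ | ((∀ i, Function.Injective (φ i)) ∧ ∀ i j, i ≠ j → ∀ u v, φ i u ≠ φ j v) ∧
    ∀ u, f s(φ 0 u, φ 0 (u + 1)) = f s(φ 1 u, φ 1 (u + 1))}

theorem sum_card_sameColorCherries_mul_le (n D : ℕ) :
    (∑ f, #(sameColorCherries n D f)) * D ≤ n ^ 3 * D ^ Fintype.card (Sym2 (Fin n)) := by
  classical
  have h1 : ∑ f, #(sameColorCherries n D f) = ∑ t : Fin n × Fin n × Fin n,
      #{f : Sym2 (Fin n) → Fin D | t ∈ sameColorCherries n D f} := by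
    have := sum_card_bipartiteAbove_eq_sum_card_bipartiteBelow
      (s := (univ : Finset (Sym2 (Fin n) → Fin D)))
      (t := (univ : Finset (Fin n × Fin n × Fin n)))
      (fun f t => t ∈ sameColorCherries n D f)
    simpa [bipartiteAbove, bipartiteBelow] using this
  rw [h1, sum_mul]
  refine (sum_le_card_nsmul _ _ (D ^ Fintype.card (Sym2 (Fin n))) ?_).trans ?_
  · rintro ⟨x, y, z⟩ -
    by_cases ht : x ≠ y ∧ x ≠ z ∧ y ≠ z
    · have := card_eq_on_pairs_mul_le (ι := Unit) D (fun _ => s(x, y)) (fun _ => s(x, z))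
        (fun _ _ _ => rfl) (by
          intro _ _ h
          rw [Sym2.congr_right] at h
          exact ht.2.2 h)
      simpa [sameColorCherries, ht] using this
    · simp [sameColorCherries, ht]
  · simp only [card_univ, Fintype.card_prod, Fintype.card_fin, smul_eq_mul]
    exact le_of_eq (by ring)

theorem hexagon_edge_injective {n : ℕ} {ψ : Fin 6 → Fin n} (h : Function.Injective ψ) :
    Function.Injective fun u => s(ψ u, ψ (u + 1)) := by
  have h6 : Function.Injective fun u : Fin 6 => s(u, u + 1) := by decide
  exact (Sym2.map.injective h).comp h6

theorem sum_card_repeatedHexagons_mul_le (n D : ℕ) :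
    (∑ f, #(repeatedHexagons n D f)) * D ^ 6 ≤ n ^ 12 * D ^ Fintype.card (Sym2 (Fin n)) := by
  classical
  have h1 : ∑ f, #(repeatedHexagons n D f) = ∑ φ : Fin 2 → Fin 6 → Fin n,
      #{f : Sym2 (Fin n) → Fin D | φ ∈ repeatedHexagons n D f} := by
    have := sum_card_bipartiteAbove_eq_sum_card_bipartiteBelow
      (s := (univ : Finset (Sym2 (Fin n) → Fin D)))
      (t := (univ : Finset (Fin 2 → Fin 6 → Fin n)))
      (fun f t => t ∈ repeatedHexagons n D f)
    simpa [bipartiteAbove, bipartiteBelow] using this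
  rw [h1, sum_mul]
  refine (sum_le_card_nsmul _ _ (D ^ Fintype.card (Sym2 (Fin n))) ?_).trans ?_
  · rintro φ -
    by_cases hφ : (∀ i, Function.Injective (φ i)) ∧ ∀ i j, i ≠ j → ∀ u v, φ i u ≠ φ j v
    · have := card_eq_on_pairs_mul_le D (fun u => s(φ 0 u, φ 0 (u + 1)))
        (fun u => s(φ 1 u, φ 1 (u + 1))) (hexagon_edge_injective (hφ.1 1)) (by
          intro u v h
          rcases Sym2.eq_iff.mp h with h | h <;> exact hφ.2 0 1 (by decide) _ _ h.1)
      rw [Fintype.card_fin] at this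
      refine le_trans (Nat.mul_le_mul_right _ (card_le_card fun f hf => ?_)) this
      simp only [repeatedHexagons, mem_filter, mem_univ, true_and] at hf ⊢
      exact hf.2
    · simp only [repeatedHexagons, mem_filter, mem_univ, true_and, hφ, false_and, filter_false,
        card_empty, zero_mul, zero_le]
  · simp only [card_univ, Fintype.card_fun, Fintype.card_fin, smul_eq_mul]
    exact le_of_eq (by ring)

theorem exists_coloring_of_few_bad {n D : ℕ} (f : Sym2 (Fin n) → Fin D) :
    ∃ c : Fin n → Fin n → ℕ, IsProperEdgeColoring n c ∧
      ¬ HasRepeat n 2 (SimpleGraph.cycleGraph 6) c ∧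
      numColors n c ≤ D + (#(sameColorCherries n D f) + #(repeatedHexagons n D f)) := by
  classical
  set bad : Finset (Sym2 (Fin n)) :=
    (sameColorCherries n D f).image (fun t => s(t.1, t.2.1)) ∪
      (repeatedHexagons n D f).image (fun φ => s(φ 0 0, φ 0 1)) with hbad
  set g : Sym2 (Fin n) → ℕ := fun e =>
    if e ∈ bad then D + Fintype.equivFin (Sym2 (Fin n)) e else f e with hg
  -- equal colours come either from equal edges or from the original colouring
  have hgeq : ∀ e e', g e = g e' → e = e' ∨ (e ∉ bad ∧ f e = f e') := by
    intro e e' h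
    have h1 := (f e).2
    have h2 := (f e').2
    simp only [hg] at h
    split_ifs at h with h3 h4 h4
    · left
      apply (Fintype.equivFin (Sym2 (Fin n))).injective
      apply Fin.ext
      omega
    · omega
    · omega
    · exact Or.inr ⟨h3, Fin.ext h⟩
  refine ⟨fun x y => g s(x, y), ⟨fun a b => congrArg g Sym2.eq_swap, ?_⟩, ?_, ?_⟩
  · intro a b b' h1 h2 h3 h
    rcases hgeq _ _ h with h | ⟨hb, h⟩
    · exact h3 (Sym2.congr_right.mp h)
    · apply hb
      rw [hbad, mem_union, mem_image]
      exact Or.inl ⟨(a, b, b'), by simp [sameColorCherries, h1, h2, h3, h], rfl⟩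
  · rintro ⟨φ, h1, h2, h3⟩
    have hstep : ∀ u, s(φ 0 u, φ 0 (u + 1)) ∉ bad ∧
        f s(φ 0 u, φ 0 (u + 1)) = f s(φ 1 u, φ 1 (u + 1)) := by
      intro u
      rcases hgeq _ _ (h3 0 1 u (u + 1) (by rw [SimpleGraph.cycleGraph_adj]; simp)) with h | h
      · rcases Sym2.eq_iff.mp h with h | h <;> exact absurd h.1 (h2 0 1 (by decide) _ _)
      · exact h
    apply (hstep 0).1
    rw [hbad, mem_union, mem_image, mem_image]
    refine Or.inr ⟨φ, ?_, rfl⟩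
    simp only [repeatedHexagons, mem_filter, mem_univ, true_and]
    exact ⟨⟨h1, h2⟩, fun u => (hstep u).2⟩
  · have hsub : ((Finset.univ.filter fun p : Fin n × Fin n => p.1 ≠ p.2).image
        fun p => g s(p.1, p.2)) ⊆ range D ∪ bad.image g := by
      intro k hk
      obtain ⟨p, -, rfl⟩ := mem_image.mp hk
      by_cases hp : s(p.1, p.2) ∈ bad
      · exact mem_union_right _ (mem_image_of_mem g hp)
      · refine mem_union_left _ (mem_range.mpr ?_)
        simp only [hg, if_neg hp]
        exact (f _).2
    have hbadcard : #bad ≤ #(sameColorCherries n D f) + #(repeatedHexagons n D f) :=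
      (card_union_le _ _).trans (add_le_add card_image_le card_image_le)
    refine (card_le_card hsub).trans ((card_union_le _ _).trans ?_)
    rw [card_range]
    exact Nat.add_le_add_left (card_image_le.trans hbadcard) _

theorem exists_coloring_numColors_le {n : ℕ} (hn : 1 ≤ n) :
    ∃ c : Fin n → Fin n → ℕ, IsProperEdgeColoring n c ∧
      ¬ HasRepeat n 2 (SimpleGraph.cycleGraph 6) c ∧
      (numColors n c : ℝ) ≤ 4 * (n : ℝ) ^ ((2 : ℝ) - 1 / 6) := by
  classical
  have hx : (1 : ℝ) ≤ n := by exact_mod_cast hn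
  set y : ℝ := (n : ℝ) ^ ((2 : ℝ) - 1 / 6) with hy
  have hx0 : (0 : ℝ) < n := by linarith
  have hy1 : 1 ≤ y := Real.one_le_rpow hx (by norm_num)
  set D : ℕ := ⌈y⌉₊ with hD
  have hyD : y ≤ D := Nat.le_ceil y
  have hDy : (D : ℝ) < y + 1 := Nat.ceil_lt_add_one (by linarith)
  have hDpos : 0 < D := by
    have : (0 : ℝ) < D := by linarith
    exact_mod_cast this
  have : Nonempty (Fin D) := ⟨⟨0, hDpos⟩⟩
  set M : ℕ := Fintype.card (Sym2 (Fin n))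
  have hD0 : (0 : ℝ) < D := by exact_mod_cast hDpos
  have s1 : ((∑ f, #(sameColorCherries n D f) : ℕ) : ℝ) ≤ (n : ℝ) ^ 3 * (D : ℝ) ^ M / D := by
    rw [le_div_iff₀ hD0]
    exact_mod_cast sum_card_sameColorCherries_mul_le n D
  have s2 : ((∑ f, #(repeatedHexagons n D f) : ℕ) : ℝ) ≤
      (n : ℝ) ^ 12 * (D : ℝ) ^ M / D ^ 6 := by
    rw [le_div_iff₀ (by positivity)]
    exact_mod_cast sum_card_repeatedHexagons_mul_le n D
  have t1 : (n : ℝ) ^ 3 / D ≤ y := by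
    rw [div_le_iff₀ hD0]
    calc (n : ℝ) ^ 3 ≤ y * y := by
          rw [hy, ← Real.rpow_add hx0, ← Real.rpow_natCast]
          exact Real.rpow_le_rpow_of_exponent_le hx (by norm_num)
      _ ≤ y * D := by gcongr
  have t2 : (n : ℝ) ^ 12 / D ^ 6 ≤ n := by
    rw [div_le_iff₀ (by positivity)]
    have hpow : (n : ℝ) ^ 12 = n * y ^ 6 := by
      have h11 : y ^ 6 = (n : ℝ) ^ 11 := by
        rw [hy, ← Real.rpow_natCast _ 6, ← Real.rpow_mul hx0.le, ← Real.rpow_natCast _ 11]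
        norm_num
      rw [h11]
      ring
    rw [hpow]
    gcongr
  have hny : (n : ℝ) ≤ y := by
    conv_lhs => rw [← Real.rpow_one (n : ℝ)]
    exact Real.rpow_le_rpow_of_exponent_le hx (by norm_num)
  obtain ⟨f, -, hf⟩ : ∃ f ∈ (univ : Finset (Sym2 (Fin n) → Fin D)),
      (#(sameColorCherries n D f) + #(repeatedHexagons n D f) : ℝ) ≤
        (n : ℝ) ^ 3 / D + (n : ℝ) ^ 12 / D ^ 6 := by
    refine exists_le_of_sum_le univ_nonempty ?_
    rw [sum_add_distrib, sum_const, card_univ, Fintype.card_fun, Fintype.card_fin, nsmul_eq_mul]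
    push_cast at s1 s2 ⊢
    calc _ ≤ _ := add_le_add s1 s2
      _ = _ := by ring
  obtain ⟨c, h1, h2, h3⟩ := exists_coloring_of_few_bad f
  refine ⟨c, h1, h2, ?_⟩
  have h3' : (numColors n c : ℝ) ≤
      D + (#(sameColorCherries n D f) + #(repeatedHexagons n D f)) := by exact_mod_cast h3
  linarith

theorem cycleGraph_six_colorable : (SimpleGraph.cycleGraph 6).Colorable 2 :=
  (SimpleGraph.cycleGraph.bicoloring_of_even 6 (by decide)).colorable

/-- There exists a bipartite graph `H` with `n^{1+ε} ≤ f₂(n,H) ≤ c·n^{2-ε}`. -/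
theorem stmt_4 :
    ∃ (V : Type) (_ : Fintype V) (H : SimpleGraph V), H.Colorable 2 ∧
      ∃ ε c : ℝ, 0 < ε ∧ 0 < c ∧ ∃ n₀ : ℕ, ∀ n ≥ n₀,
        (n : ℝ) ^ ((1 : ℝ) + ε) ≤ (repeatNumber 2 n H : ℝ) ∧
          (repeatNumber 2 n H : ℝ) ≤ c * (n : ℝ) ^ ((2 : ℝ) - ε) := by
  refine ⟨Fin 6, inferInstance, SimpleGraph.cycleGraph 6, cycleGraph_six_colorable, 1 / 6, 4,
    by norm_num, by norm_num, 4000000000000, fun n hn => ?_⟩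
  obtain ⟨c, h1, h2, h3⟩ := exists_coloring_numColors_le (n := n) (by omega)
  constructor
  · obtain ⟨c', h1', h2', h3'⟩ := Nat.sInf_mem (s := { C | ∃ c : Fin n → Fin n → ℕ,
      IsProperEdgeColoring n c ∧ numColors n c = C ∧
        ¬ HasRepeat n 2 (SimpleGraph.cycleGraph 6) c }) ⟨_, c, h1, rfl, h2⟩
    rw [repeatNumber, ← h2']
    exact rpow_le_numColors hn h1' h3'
  · refine le_trans ?_ h3
    have h : repeatNumber 2 n (SimpleGraph.cycleGraph 6) ≤ numColors n c :=
      Nat.sInf_le ⟨c, h1, rfl, h2⟩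
    exact_mod_cast h
end

section
/- For any graph H containing a cycle, there exist an integer k ≥ 2, a constant c > 0 and n₀ such that for all n ≥ n₀, f_k(n,H) ≤ c·n. -/
open Finset

open MvPolynomial in
/-- A system in which a power of every coordinate equals a polynomial of lower total degree
has boundedly many solutions. -/
theorem card_le_of_pow_eq_eval {F U J : Type*} [Field F] [Fintype F] [Fintype U] [Fintype J]
    (D : ℕ) (x : J → U → F) (hx : Function.Injective x)
    (h : ∀ u, ∃ d ≤ D, ∃ q : MvPolynomial U F, q.totalDegree < d ∧
      ∀ j, x j u ^ d = eval (x j) q) :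
    Fintype.card J ≤ D ^ Fintype.card U := by
  classical
  choose d hdD q hq hxq using h
  let E : MvPolynomial U F →ₗ[F] (J → F) :=
    { toFun := fun p j => eval (x j) p
      map_add' := fun p r => by ext; simp
      map_smul' := fun a p => by ext; simp }
  have hE : ∀ p j, E p j = eval (x j) p := fun _ _ => rfl
  let b : (U → Fin D) → (J → F) := fun a =>
    E (monomial (Finsupp.equivFunOnFinite.symm fun u => (a u : ℕ)) 1)
  have key : ∀ N : ℕ, ∀ p : MvPolynomial U F, p.totalDegree < N →
      E p ∈ Submodule.span F (Set.range b) := by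
    intro N
    induction N with
    | zero => intro p hp; omega
    | succ N ih =>
      intro p hp
      rw [p.as_sum, map_sum]
      refine Submodule.sum_mem _ fun s hs => ?_
      have hsN : s.degree ≤ N := by
        have := le_totalDegree hs
        rw [Finsupp.degree_apply]
        exact this.trans (by omega)
      by_cases hall : ∀ u, s u < D
      · have : monomial s (coeff s p) = coeff s p •
            monomial (Finsupp.equivFunOnFinite.symm fun u => ((⟨s u, hall u⟩ : Fin D) : ℕ))
              (1 : F) := by
          rw [smul_monomial, smul_eq_mul, mul_one]
          congr 1
          ext u
          simp
        rw [this, map_smul]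
        exact Submodule.smul_mem _ _ (Submodule.subset_span ⟨fun u => ⟨s u, hall u⟩, rfl⟩)
      · push Not at hall
        obtain ⟨u, hu⟩ := hall
        have hsplit : s = (s - Finsupp.single u (d u)) + Finsupp.single u (d u) := by
          refine (tsub_add_cancel_of_le ?_).symm
          rw [Finsupp.single_le_iff]
          exact (hdD u).trans hu
        have hdeg : (s - Finsupp.single u (d u)).degree + d u = s.degree := by
          conv_rhs => rw [hsplit]
          rw [map_add, Finsupp.degree_single]
        have hEq : E (monomial s (coeff s p)) =
            E (monomial (s - Finsupp.single u (d u)) (coeff s p) * q u) := by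
          ext j
          have hmul := monomial_add_single (s := s - Finsupp.single u (d u)) (n := u) (e := d u)
            (a := coeff s p)
          rw [← hsplit] at hmul
          rw [hE, hE, hmul, map_mul, map_mul, map_pow, eval_X, hxq]
        rw [hEq]
        apply ih
        refine (totalDegree_mul _ _).trans_lt ?_
        have h1 := totalDegree_monomial_le (s - Finsupp.single u (d u)) (coeff s p)
        have h2 : ((s - Finsupp.single u (d u)).sum fun _ => id) =
            (s - Finsupp.single u (d u)).degree := by
          rw [Finsupp.degree_apply]; rfl
        have h3 := hq u
        omega
  have htop : Submodule.span F (Set.range b) = ⊤ := by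
    refine Submodule.eq_top_iff'.2 fun g => ?_
    have : g = E (∑ j, g j • indicator (x j)) := by
      ext j
      rw [hE, map_sum, Finset.sum_eq_single j]
      · rw [smul_eval, eval_indicator_apply_eq_one, mul_one]
      · intro i _ hij
        rw [smul_eval, eval_indicator_apply_eq_zero _ _ (fun h => hij (hx h).symm), mul_zero]
      · simp
    rw [this]
    exact key _ _ (Nat.lt_succ_self _)
  have := finrank_range_le_card (R := F) b
  rw [Set.finrank, htop, finrank_top, Module.finrank_fintype_fun_eq_card] at this
  simpa using this

/-- The unique `c` with `c.1 * x ^ 2 + c.2 * x ^ 3 = a` and `c.1 * z ^ 2 + c.2 * z ^ 3 = b`,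
for distinct nonzero `x` and `z`. -/
def interpolant {F : Type*} [Field F] (x z a b : F) : F × F :=
  ((x * (b / z ^ 2) - z * (a / x ^ 2)) / (x - z), (a / x ^ 2 - b / z ^ 2) / (x - z))

theorem interpolant_swap {F : Type*} [Field F] (x z a b : F) :
    interpolant x z a b = interpolant z x b a := by
  unfold interpolant
  rw [← neg_div_neg_eq, ← neg_div_neg_eq (a / x ^ 2 - b / z ^ 2)]
  simp only [neg_sub]

theorem interpolant_spec {F : Type*} [Field F] {x z : F} (a b : F) (hx : x ≠ 0) (hxz : x ≠ z) :
    (interpolant x z a b).1 * x ^ 2 + (interpolant x z a b).2 * x ^ 3 = a := by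
  have h : x - z ≠ 0 := sub_ne_zero.2 hxz
  have h1 : (interpolant x z a b).1 + (interpolant x z a b).2 * x = a / x ^ 2 := by
    unfold interpolant
    generalize a / x ^ 2 = a'
    generalize b / z ^ 2 = b'
    field_simp
    ring
  rw [eq_div_iff (pow_ne_zero 2 hx)] at h1
  linear_combination h1

/-- The colour of the edge between two points of the plane `F × F`. -/
def planeColor {F : Type*} [Field F] [DecidableEq F] (v w : F × F) : (F × F) ⊕ (F × F) :=
  if v.1 = w.1 then Sum.inl (v.2 + w.2, v.1 ^ 7 + v.2 * w.2)
  else Sum.inr (interpolant v.1 w.1 (v.2 - w.1) (w.2 - v.1))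

section planeColor

variable {F : Type*} [Field F] [DecidableEq F]

theorem planeColor_comm (v w : F × F) : planeColor v w = planeColor w v := by
  unfold planeColor
  by_cases h : v.1 = w.1
  · rw [if_pos h, if_pos h.symm, h, add_comm, mul_comm]
  · rw [if_neg h, if_neg (Ne.symm h), interpolant_swap]

theorem planeColor_eq_inl {v w c : F × F} (h : planeColor v w = Sum.inl c) :
    v.1 = w.1 ∧ v.2 + w.2 = c.1 ∧ v.1 ^ 7 + v.2 * w.2 = c.2 := by
  unfold planeColor at h
  split_ifs at h with hvw
  obtain rfl := Sum.inl_injective h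
  exact ⟨hvw, rfl, rfl⟩

theorem planeColor_eq_inr {v w c : F × F} (hv : v.1 ≠ 0) (h : planeColor v w = Sum.inr c) :
    v.2 = w.1 + (c.1 * v.1 ^ 2 + c.2 * v.1 ^ 3) := by
  unfold planeColor at h
  split_ifs at h with hvw
  obtain rfl := Sum.inr_injective h
  rw [interpolant_spec _ _ hv hvw]
  ring

theorem planeColor_right_injective {v w w' : F × F} (hv : v.1 ≠ 0) (hw : w.1 ≠ 0)
    (hw' : w'.1 ≠ 0) (h : planeColor v w = planeColor v w') : w = w' := by
  rcases hc : planeColor v w with c | c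
  · obtain ⟨h1, h2, -⟩ := planeColor_eq_inl hc
    obtain ⟨h1', h2', -⟩ := planeColor_eq_inl (h ▸ hc)
    exact Prod.ext (h1.symm.trans h1') (add_left_cancel (h2.trans h2'.symm))
  · have hc' : planeColor v w' = Sum.inr c := h ▸ hc
    have h1 : w.1 = w'.1 :=
      add_right_cancel ((planeColor_eq_inr hv hc).symm.trans (planeColor_eq_inr hv hc'))
    have h2 := planeColor_eq_inr hw (planeColor_comm w v ▸ hc)
    have h2' := planeColor_eq_inr hw' (planeColor_comm w' v ▸ hc')
    rw [← h1] at h2'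
    exact Prod.ext h1 (h2.trans h2'.symm)

open MvPolynomial in
/-- Colour-isomorphic copies in the plane of a graph in which every vertex `u` has two distinct
neighbours `r u` and `s u` are determined by their first coordinates, and there are boundedly many
of them. -/
theorem card_le_of_planeColor_eq {U J : Type*} [Fintype F] [Fintype U] [Fintype J]
    (z : J → U → F × F) (hz : Function.Injective z) (hz0 : ∀ j u, (z j u).1 ≠ 0)
    (r s : U → U) (hrs : ∀ j u, z j (r u) ≠ z j (s u))
    (hr : ∀ i j u, planeColor (z i u) (z i (r u)) = planeColor (z j u) (z j (r u)))
    (hs : ∀ i j u, planeColor (z i u) (z i (s u)) = planeColor (z j u) (z j (s u))) :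
    Fintype.card J ≤ 7 ^ Fintype.card U := by
  rcases isEmpty_or_nonempty J with hJ | ⟨⟨j₀⟩⟩
  · simp
  let x : J → U → F := fun j u => (z j u).1
  have hcol : ∀ u, ∃ a b, a ≠ b ∧ ∀ j, planeColor (z j u) (z j (r u)) = a ∧
      planeColor (z j u) (z j (s u)) = b := fun u =>
    ⟨_, _, fun h => hrs j₀ u (planeColor_right_injective (hz0 _ _) (hz0 _ _) (hz0 _ _) h),
      fun j => ⟨hr j j₀ u, hs j j₀ u⟩⟩
  have hinr : ∀ (u w : U) (c : F × F), (∀ j, planeColor (z j u) (z j w) = Sum.inr c) →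
      ∃ Y : MvPolynomial U F, Y.totalDegree ≤ 3 ∧ ∀ j, (z j u).2 = eval (x j) Y := by
    intro u w c h
    refine ⟨X w + (C c.1 * X u ^ 2 + C c.2 * X u ^ 3), ?_, fun j => ?_⟩
    · simp only [← mem_restrictTotalDegree]
      refine add_mem ?_ (add_mem ?_ ?_) <;> rw [mem_restrictTotalDegree]
      · simp
      · exact (totalDegree_mul _ _).trans (by simp)
      · exact (totalDegree_mul _ _).trans (by simp)
    · simpa [x] using planeColor_eq_inr (hz0 j u) (h j)
  have hY : ∀ u, ∃ Y : MvPolynomial U F, Y.totalDegree ≤ 3 ∧ ∀ j, (z j u).2 = eval (x j) Y := by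
    intro u
    obtain ⟨a, b, hab, h⟩ := hcol u
    rcases a with a | a
    · rcases b with b | b
      · have ha := fun j => planeColor_eq_inl (h j).1
        have hb := fun j => planeColor_eq_inl (h j).2
        have hne : a.1 - b.1 ≠ 0 := by
          intro h0
          refine hrs j₀ u (Prod.ext ((ha j₀).1.symm.trans (hb j₀).1) ?_)
          linear_combination (ha j₀).2.1 - (hb j₀).2.1 + h0
        refine ⟨C ((a.2 - b.2) / (a.1 - b.1)), by simp, fun j => ?_⟩
        rw [eval_C, eq_div_iff hne]
        linear_combination (ha j).2.2 - (hb j).2.2 - (z j u).2 * ((ha j).2.1 - (hb j).2.1)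
      · exact hinr u (s u) b fun j => (h j).2
    · exact hinr u (r u) a fun j => (h j).1
  choose Y hYdeg hYeval using hY
  have hx : Function.Injective x := by
    intro i j hij
    refine hz (funext fun u => Prod.ext (congrFun hij u) ?_)
    rw [hYeval, hYeval, hij]
  have hinl : ∀ (u w : U) (c : F × F), (∀ j, planeColor (z j u) (z j w) = Sum.inl c) →
      ∃ d ≤ 7, ∃ q : MvPolynomial U F, q.totalDegree < d ∧ ∀ j, x j u ^ d = eval (x j) q := by
    intro u w c h
    refine ⟨7, le_rfl, C c.2 - Y u * Y w, ?_, fun j => ?_⟩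
    · rw [Nat.lt_succ_iff, ← mem_restrictTotalDegree]
      refine sub_mem ?_ ?_ <;> rw [mem_restrictTotalDegree]
      · simp
      · exact (totalDegree_mul _ _).trans (add_le_add (hYdeg u) (hYdeg w))
    · rw [map_sub, map_mul, eval_C, ← hYeval, ← hYeval]
      linear_combination (planeColor_eq_inl (h j)).2.2
  refine card_le_of_pow_eq_eval 7 x hx fun u => ?_
  obtain ⟨a, b, hab, h⟩ := hcol u
  rcases a with a | a
  · exact hinl u (r u) a fun j => (h j).1
  rcases b with b | b
  · exact hinl u (s u) b fun j => (h j).2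
  have ha := fun j => planeColor_eq_inr (hz0 j u) (h j).1
  have hb := fun j => planeColor_eq_inr (hz0 j u) (h j).2
  by_cases h3 : a.2 - b.2 = 0
  · have h2 : a.1 - b.1 ≠ 0 := fun h2 =>
      hab (congrArg Sum.inr (Prod.ext (sub_eq_zero.1 h2) (sub_eq_zero.1 h3)))
    refine ⟨2, by norm_num, C (a.1 - b.1)⁻¹ * (X (s u) - X (r u)), ?_, fun j => ?_⟩
    · rw [Nat.lt_succ_iff]
      refine (totalDegree_mul _ _).trans ?_
      rw [totalDegree_C, zero_add]
      exact (totalDegree_sub _ _).trans (by simp)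
    · simp only [map_mul, map_sub, eval_C, eval_X]
      rw [eq_inv_mul_iff_mul_eq₀ (by simpa using h2)]
      simp only [x]
      linear_combination hb j - ha j - (z j u).1 ^ 3 * h3
  · refine ⟨3, by norm_num,
      C (a.2 - b.2)⁻¹ * (X (s u) - X (r u) - C (a.1 - b.1) * X u ^ 2), ?_, fun j => ?_⟩
    · rw [Nat.lt_succ_iff]
      refine (totalDegree_mul _ _).trans ?_
      rw [totalDegree_C, zero_add]
      refine (totalDegree_sub _ _).trans (max_le ((totalDegree_sub _ _).trans (by simp)) ?_)
      refine (totalDegree_mul _ _).trans ?_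
      rw [totalDegree_C, totalDegree_X_pow]
    · simp only [map_mul, map_sub, map_pow, eval_C, eval_X]
      rw [eq_inv_mul_iff_mul_eq₀ (by simpa using h3)]
      simp only [x]
      linear_combination hb j - ha j

end planeColor

/-- For every `n ≥ 1` there is a prime `p = O(√n)` such that at least `n` points of the plane over
`ZMod p` have nonzero first coordinate. -/
theorem exists_prime_plane (n : ℕ) (hn : 1 ≤ n) :
    ∃ p : ℕ, p.Prime ∧ n ≤ (p - 1) * p ∧ p * p ≤ 16 * n := by
  obtain ⟨p, hp, hlt, hle⟩ := Nat.exists_prime_lt_and_le_two_mul (n.sqrt + 1) (by omega)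
  have h1 := Nat.sqrt_le n
  have h2 := Nat.lt_succ_sqrt n
  have h3 : 1 ≤ n.sqrt := Nat.sqrt_pos.2 hn
  refine ⟨p, hp, ?_, ?_⟩
  · have : (n.sqrt + 1) * (n.sqrt + 1) ≤ (p - 1) * p := Nat.mul_le_mul (by omega) hlt.le
    exact (h2.trans_le this).le
  · have : p * p ≤ (4 * n.sqrt) * (4 * n.sqrt) := Nat.mul_le_mul (by omega) (by omega)
    nlinarith

/-- A graph with a cycle has a nonempty set of vertices, each with two distinct neighbours
in the set. -/
theorem exists_two_neighbours {V : Type*} {H : SimpleGraph V} (hH : ¬ H.IsAcyclic) :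
    ∃ U : Set V, U.Nonempty ∧ ∀ u ∈ U, ∃ r ∈ U, ∃ s ∈ U, r ≠ s ∧ H.Adj u r ∧ H.Adj u s := by
  simp only [SimpleGraph.IsAcyclic, not_forall, not_not] at hH
  obtain ⟨v, w, hw⟩ := hH
  refine ⟨w.toSubgraph.verts, ⟨v, w.start_mem_verts_toSubgraph⟩, fun u hu => ?_⟩
  obtain ⟨r, s, hrs, h⟩ := Set.ncard_eq_two.1
    (hw.ncard_neighborSet_toSubgraph_eq_two (w.mem_verts_toSubgraph.1 hu))
  have hr : w.toSubgraph.Adj u r := (h ▸ Set.mem_insert r {s} : r ∈ w.toSubgraph.neighborSet u)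
  have hs : w.toSubgraph.Adj u s :=
    (h ▸ Set.mem_insert_of_mem r rfl : s ∈ w.toSubgraph.neighborSet u)
  exact ⟨r, hr.snd_mem, s, hs.snd_mem, hrs, hr.adj_sub, hs.adj_sub⟩

/-- For any graph `H` containing a cycle, there exists `k` with `f_k(n,H) = O(n)`. -/
theorem stmt_5 (V : Type) [Fintype V] (H : SimpleGraph V) (hH : ¬ H.IsAcyclic) :
    ∃ k : ℕ, 2 ≤ k ∧ ∃ c : ℝ, 0 < c ∧ ∃ n₀ : ℕ, ∀ n ≥ n₀,
      (repeatNumber k n H : ℝ) ≤ c * (n : ℝ) := by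
  classical
  obtain ⟨U, ⟨u₀, hu₀⟩, hU⟩ := exists_two_neighbours hH
  choose r hrU s hsU hrs hHr hHs using hU
  refine ⟨7 ^ Fintype.card U + 1, Nat.succ_le_succ (Nat.one_le_pow _ _ (by norm_num)),
    32, by norm_num, 1, fun n hn => ?_⟩
  obtain ⟨p, hp, hnp, hpn⟩ := exists_prime_plane n hn
  have : Fact p.Prime := ⟨hp⟩
  obtain ⟨e⟩ : Nonempty (Fin n ↪ (ZMod p)ˣ × ZMod p) := by
    refine Function.Embedding.nonempty_of_card_le ?_
    rwa [Fintype.card_fin, Fintype.card_prod, ZMod.card_units, ZMod.card]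
  let P : Fin n → ZMod p × ZMod p := fun a => ((e a).1, (e a).2)
  have hP : Function.Injective P := fun a b h =>
    e.injective (Prod.ext (Units.ext (congrArg Prod.fst h)) (Prod.ext_iff.1 h).2)
  have hP0 : ∀ a, (P a).1 ≠ 0 := fun a => (e a).1.ne_zero
  let code := Fintype.equivFin ((ZMod p × ZMod p) ⊕ (ZMod p × ZMod p))
  let col : Fin n → Fin n → ℕ := fun a b => code (planeColor (P a) (P b))
  have hcol : ∀ {a b a' b'}, col a b = col a' b' →
      planeColor (P a) (P b) = planeColor (P a') (P b') := fun h =>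
    code.injective (Fin.ext h)
  have hproper : IsProperEdgeColoring n col := by
    refine ⟨fun a b => ?_, fun a b b' _ _ hbb' h => hbb' (hP ?_)⟩
    · simp only [col, planeColor_comm (P a)]
    · exact planeColor_right_injective (hP0 a) (hP0 b) (hP0 b') (hcol h)
  have hrep : ¬ HasRepeat n (7 ^ Fintype.card U + 1) H col := by
    rintro ⟨φ, hinj, hdisj, hiso⟩
    have := card_le_of_planeColor_eq (fun i (u : U) => P (φ i u))
      (fun i j hij => by
        by_contra hne
        exact hdisj i j hne u₀ u₀ (hP (congrFun hij ⟨u₀, hu₀⟩)))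
      (fun _ _ => hP0 _)
      (fun u => ⟨r u u.2, hrU u u.2⟩) (fun u => ⟨s u u.2, hsU u u.2⟩)
      (fun i u h => hrs u u.2 (hinj i (hP h)))
      (fun i j u => hcol (hiso i j _ _ (hHr u u.2)))
      (fun i j u => hcol (hiso i j _ _ (hHs u u.2)))
    rw [Fintype.card_fin] at this
    omega
  have hcard : numColors n col ≤ 32 * n := by
    have hsub : numColors n col ≤ 2 * (p * p) := by
      unfold numColors
      refine (Finset.card_le_card (t := Finset.range (2 * (p * p))) fun m hm => ?_).trans
        (Finset.card_range _).le
      obtain ⟨ab, -, rfl⟩ := Finset.mem_image.1 hm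
      refine Finset.mem_range.2 ((code _).isLt.trans_le ?_)
      simp [ZMod.card, two_mul]
    omega
  have hle : repeatNumber (7 ^ Fintype.card U + 1) n H ≤ 32 * n :=
    le_trans (Nat.sInf_le ⟨col, hproper, rfl, hrep⟩) hcard
  exact_mod_cast hle
end

section
/- For any tree T with m ≥ 1 edges and any k ≥ 2, setting q = (4k(km+1)(k²−k+1))^{1/(k−1)}, there exists n₀ such that for all n ≥ n₀, f_k(n,T) ≥ n^{k/(k−1)}/q. -/
open Finset

open Classical in
/-- A finite set on which a symmetric relation is dense has a nonempty subset on which the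
relation has large minimum degree. -/
theorem exists_subset_forall_lt_card_filter_s6 {α : Type*} (R : α → α → Prop)
    (hR : ∀ a b, R a b → R b a) (D : ℕ) (S : Finset α)
    (h : 2 * D * #S < #{p ∈ S ×ˢ S | R p.1 p.2}) :
    ∃ S' ⊆ S, S'.Nonempty ∧ ∀ v ∈ S', D < #{w ∈ S' | R v w} := by
  induction S using Finset.strongInduction with
  | H S ih =>
    by_cases hall : ∀ v ∈ S, D < #{w ∈ S | R v w}
    · refine ⟨S, Subset.rfl, ?_, hall⟩
      by_contra hS
      rw [not_nonempty_iff_eq_empty] at hS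
      simp [hS] at h
    · push Not at hall
      obtain ⟨v, hv, hvD⟩ := hall
      have hcover : ({p ∈ S ×ˢ S | R p.1 p.2} : Finset (α × α)) ⊆
          ({p ∈ S.erase v ×ˢ S.erase v | R p.1 p.2} ∪
            ({w ∈ S | R v w} : Finset α).image (fun w => (v, w))) ∪
            ({w ∈ S | R v w} : Finset α).image (fun w => (w, v)) := by
        rintro ⟨a, b⟩ hab
        simp only [mem_filter, mem_product, mem_union, mem_image, mem_erase, Prod.mk.injEq] at *
        obtain ⟨⟨ha, hb⟩, hr⟩ := hab
        by_cases hav : a = v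
        · subst hav
          exact Or.inl (Or.inr ⟨b, ⟨hb, hr⟩, rfl, rfl⟩)
        by_cases hbv : b = v
        · subst hbv
          exact Or.inr ⟨a, ⟨ha, hR _ _ hr⟩, rfl, rfl⟩
        · exact Or.inl (Or.inl ⟨⟨⟨hav, ha⟩, hbv, hb⟩, hr⟩)
      have h1 := (card_le_card hcover).trans (card_union_le _ _)
      have h2 := card_union_le ({p ∈ S.erase v ×ˢ S.erase v | R p.1 p.2} : Finset (α × α))
        (({w ∈ S | R v w} : Finset α).image (fun w => (v, w)))
      have h3 := card_image_le (s := ({w ∈ S | R v w} : Finset α)) (f := fun w => (v, w))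
      have h4 := card_image_le (s := ({w ∈ S | R v w} : Finset α)) (f := fun w => (w, v))
      have h5 := card_erase_add_one hv
      obtain ⟨S', hS', hrest⟩ := ih (S.erase v) (erase_ssubset hv) (by
        rw [← h5, mul_add] at h
        omega)
      exact ⟨S', hS'.trans (erase_subset _ _), hrest⟩

/-- The edges joining corresponding entries of `v` and `w` all have the same colour. -/
def IsMonochromaticPair {n k : ℕ} (c : Fin n → Fin n → ℕ) (v w : Fin k → Fin n) : Prop :=
  (∀ i, v i ≠ w i) ∧ ∀ i j, c (v i) (w i) = c (v j) (w j)

theorem IsMonochromaticPair.symm {n k : ℕ} {c : Fin n → Fin n → ℕ}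
    (hc : IsProperEdgeColoring n c) {v w : Fin k → Fin n} (h : IsMonochromaticPair c v w) :
    IsMonochromaticPair c w v :=
  ⟨fun i => (h.1 i).symm, fun i j => by rw [hc.1 (w i), hc.1 (w j)]; exact h.2 i j⟩

/-- Two neighbours of a tuple that agree in one entry are equal. -/
theorem IsMonochromaticPair.eq_of_apply_eq {n k : ℕ} {c : Fin n → Fin n → ℕ}
    (hc : IsProperEdgeColoring n c) {v w w' : Fin k → Fin n} (h : IsMonochromaticPair c v w)
    (h' : IsMonochromaticPair c v w') {i : Fin k} (hi : w i = w' i) : w = w' := by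
  funext j
  by_contra hne
  refine hc.2 (v j) (w j) (w' j) (h.1 j) (h'.1 j) hne ?_
  rw [h.2 j i, h'.2 j i, hi]

open Classical in
/-- Trees embed greedily, with all entries distinct, into a family of injective tuples in which
every tuple has many neighbours. -/
theorem exists_tree_embedding {n k D : ℕ} {c : Fin n → Fin n → ℕ}
    (hc : IsProperEdgeColoring n c) (S : Finset (Fin k → Fin n)) (hS : S.Nonempty)
    (hinj : ∀ v ∈ S, Function.Injective v)
    (hdeg : ∀ v ∈ S, D < #{w ∈ S | IsMonochromaticPair c v w}) (N : ℕ) :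
    ∀ (V : Type) [Fintype V] (T : SimpleGraph V), T.IsTree → Fintype.card V = N + 1 →
      k * (k * N) ≤ D → ∃ φ : V → Fin k → Fin n, (∀ u, φ u ∈ S) ∧
        (∀ u v, T.Adj u v → IsMonochromaticPair c (φ u) (φ v)) ∧
        Function.Injective fun p : V × Fin k => φ p.1 p.2 := by
  induction N with
  | zero =>
    intro V _ T hT hV _
    obtain ⟨s, hs⟩ := hS
    have hsub : Subsingleton V := Fintype.card_le_one_iff_subsingleton.mp (by omega)
    refine ⟨fun _ => s, fun _ => hs, fun u v huv => ?_, ?_⟩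
    · exact absurd (Subsingleton.elim u v) huv.ne
    · rintro ⟨u, i⟩ ⟨v, j⟩ h
      exact Prod.ext (Subsingleton.elim _ _) (hinj s hs h)
  | succ N ih =>
    intro V _ T hT hV hD
    have hnt : Nontrivial V := Fintype.one_lt_card_iff_nontrivial.mp (by omega)
    obtain ⟨l, hl⟩ := hT.exists_vert_degree_one_of_nontrivial
    have hT' : (T.induce {l}ᶜ).IsTree :=
      ⟨hT.1.induce_compl_singleton_of_degree_eq_one hl, hT.2.induce _⟩
    obtain ⟨p, hlp, hp⟩ := SimpleGraph.degree_eq_one_iff_existsUnique_adj.mp hl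
    have hcard : Fintype.card ({l}ᶜ : Set V) = N + 1 := by
      rw [Fintype.card_compl_set, hV]
      simp
    obtain ⟨φ, hφS, hφR, hφinj⟩ := ih _ _ hT' hcard
      ((Nat.mul_le_mul_left _ (Nat.mul_le_mul_left _ (Nat.le_succ N))).trans hD)
    have hpl : p ∈ ({l}ᶜ : Set V) := by simpa using hlp.ne'
    set v := φ ⟨p, hpl⟩ with hv
    have hbad : #{w ∈ {w ∈ S | IsMonochromaticPair c v w} |
        ∃ i u j, w i = φ u j} ≤ D := by
      have hX : #(univ.image fun q : ({l}ᶜ : Set V) × Fin k => φ q.1 q.2) ≤ k * (N + 1) := by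
        refine card_image_le.trans ?_
        rw [card_univ, Fintype.card_prod, hcard, Fintype.card_fin, mul_comm]
      have hsub : ({w ∈ {w ∈ S | IsMonochromaticPair c v w} |
          ∃ i u j, w i = φ u j} : Finset (Fin k → Fin n)) ⊆
          (univ : Finset (Fin k)).biUnion fun i =>
            {w ∈ {w ∈ S | IsMonochromaticPair c v w} |
              w i ∈ univ.image fun q : ({l}ᶜ : Set V) × Fin k => φ q.1 q.2} := by
        intro w hw
        rw [mem_filter] at hw
        obtain ⟨hw, i, u, j, hij⟩ := hw
        exact mem_biUnion.mpr ⟨i, mem_univ _, mem_filter.mpr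
          ⟨hw, mem_image.mpr ⟨(u, j), mem_univ _, hij.symm⟩⟩⟩
      refine (card_le_card hsub).trans ((card_biUnion_le_card_mul _ _ (k * (N + 1)) ?_).trans ?_)
      · intro i _
        refine le_trans (card_le_card_of_injOn (fun w => w i) ?_ ?_) hX
        · intro w hw
          exact (mem_filter.mp hw).2
        · intro w hw w' hw' hww
          have h1 := (mem_filter.mp (mem_filter.mp hw).1).2
          have h2 := (mem_filter.mp (mem_filter.mp hw').1).2
          exact h1.eq_of_apply_eq hc h2 hww
      · simpa using hD
    obtain ⟨w, hw, hwbad⟩ : ∃ w ∈ ({w ∈ S | IsMonochromaticPair c v w} : Finset _),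
        ¬ ∃ i u j, w i = φ u j := by
      by_contra! hcon
      have := hdeg v (hφS _)
      rw [filter_true_of_mem hcon] at hbad
      omega
    obtain ⟨hwS, hvw⟩ := mem_filter.mp hw
    refine ⟨fun u => if h : u ∈ ({l}ᶜ : Set V) then φ ⟨u, h⟩ else w, ?_, ?_, ?_⟩
    · intro u
      dsimp only
      split_ifs
      exacts [hφS _, hwS]
    · intro a b hab
      dsimp only
      split_ifs with ha hb hb
      · exact hφR ⟨a, ha⟩ ⟨b, hb⟩ hab
      · have hbl : b = l := by simpa using hb
        subst hbl
        have hap : a = p := hp a hab.symm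
        subst hap
        exact hvw
      · have hal : a = l := by simpa using ha
        subst hal
        have hbp : b = p := hp b hab
        subst hbp
        exact hvw.symm hc
      · have hal : a = l := by simpa using ha
        have hbl : b = l := by simpa using hb
        exact absurd (hal.trans hbl.symm) hab.ne
    · rintro ⟨a, i⟩ ⟨b, j⟩ hab
      dsimp only at hab
      split_ifs at hab with ha hb hb
      · have := @hφinj (⟨a, ha⟩, i) (⟨b, hb⟩, j) hab
        simpa using this
      · exact absurd ⟨_, _, _, hab.symm⟩ hwbad
      · exact absurd ⟨_, _, _, hab⟩ hwbad
      · have hal : a = l := by simpa using ha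
        have hbl : b = l := by simpa using hb
        exact Prod.ext (hal.trans hbl.symm) (hinj w hwS hab)

open Classical in
/-- Convexity bound for the number of pairs of injective tuples joined by edges of one colour. -/
theorem pow_le_card_isMonochromaticPair {n K : ℕ} {c : Fin n → Fin n → ℕ}
    (hc : IsProperEdgeColoring n c) :
    (n * (n - 1) - numColors n c * K) ^ (K + 1) ≤ numColors n c ^ K *
      #{p ∈ ({v | Function.Injective v} : Finset (Fin (K + 1) → Fin n)) ×ˢ
          ({v | Function.Injective v} : Finset (Fin (K + 1) → Fin n)) |
          IsMonochromaticPair c p.1 p.2} := by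
  set E : Finset (Fin n × Fin n) := univ.filter fun p => p.1 ≠ p.2 with hE
  set I : Finset ℕ := E.image fun p => c p.1 p.2 with hI
  set P := ({p ∈ ({v | Function.Injective v} : Finset (Fin (K + 1) → Fin n)) ×ˢ
          ({v | Function.Injective v} : Finset (Fin (K + 1) → Fin n)) |
          IsMonochromaticPair c p.1 p.2} : Finset _) with hP
  have hnum : numColors n c = #I := rfl
  have hEcard : #E = n * (n - 1) := by
    have : E = (univ : Finset (Fin n)).offDiag := by ext; simp [hE]
    rw [this, offDiag_card, card_univ, Fintype.card_fin, Nat.mul_sub_one]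
  have hEsum : #E = ∑ a ∈ I, #{p ∈ E | c p.1 p.2 = a} :=
    card_eq_sum_card_image _ _
  have hPsum : #P = ∑ a ∈ I, #{p ∈ P | c (p.1 0) (p.2 0) = a} := by
    refine card_eq_sum_card_fiberwise fun p hp => ?_
    have hp' := (mem_filter.mp hp).2
    exact mem_image.mpr ⟨(p.1 0, p.2 0), by simpa [hE] using hp'.1 0, rfl⟩
  have hfib : ∀ a ∈ I, (#{p ∈ E | c p.1 p.2 = a} - K) ^ (K + 1) ≤
      #{p ∈ P | c (p.1 0) (p.2 0) = a} := by
    intro a _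
    set F := ({p ∈ E | c p.1 p.2 = a} : Finset _) with hF
    have hFm : ∀ q : F, q.1.1 ≠ q.1.2 ∧ c q.1.1 q.1.2 = a := fun q => by
      obtain ⟨hq, hqa⟩ := mem_filter.mp q.2
      exact ⟨(mem_filter.mp hq).2, hqa⟩
    have h1 := Nat.pow_sub_le_descFactorial #F (K + 1)
    rw [Nat.add_sub_add_right] at h1
    refine h1.trans ?_
    have h2 : Fintype.card (Fin (K + 1) ↪ F) = (#F).descFactorial (K + 1) := by
      rw [Fintype.card_embedding_eq, Fintype.card_coe, Fintype.card_fin]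
    rw [← h2, ← card_univ]
    refine card_le_card_of_injOn
      (fun f => (fun i => (f i).1.1, fun i => (f i).1.2)) ?_ ?_
    · intro f _
      have hfst : Function.Injective fun i => (f i).1.1 := by
        intro i j hij
        dsimp only at hij
        have hi := hFm (f i)
        have hj := hFm (f j)
        apply f.injective
        refine Subtype.ext (Prod.ext hij ?_)
        by_contra hne
        refine hc.2 (f i).1.1 (f i).1.2 (f j).1.2 hi.1 (hij ▸ hj.1) hne ?_
        rw [hi.2, hij, hj.2]
      have hsnd : Function.Injective fun i => (f i).1.2 := by
        intro i j hij
        dsimp only at hij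
        have hi := hFm (f i)
        have hj := hFm (f j)
        apply f.injective
        refine Subtype.ext (Prod.ext ?_ hij)
        by_contra hne
        refine hc.2 (f i).1.2 (f i).1.1 (f j).1.1 hi.1.symm (hij ▸ hj.1.symm) hne ?_
        rw [hc.1, hi.2, hij, hc.1, hj.2]
      simp only [hP, coe_filter, mem_filter, mem_product, mem_univ, true_and, Set.mem_ofPred_eq]
      exact ⟨⟨⟨hfst, hsnd⟩, fun i => (hFm (f i)).1,
        fun i j => (hFm (f i)).2.trans (hFm (f j)).2.symm⟩, (hFm (f 0)).2⟩
    · intro f _ g _ hfg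
      ext1 i
      have h3 := congrFun (congrArg Prod.fst hfg) i
      have h4 := congrFun (congrArg Prod.snd hfg) i
      exact Subtype.ext (Prod.ext h3 h4)
  rw [hnum, ← hEcard]
  have hlin : #E - #I * K ≤ ∑ a ∈ I, (#{p ∈ E | c p.1 p.2 = a} - K) := by
    rw [hEsum, tsub_le_iff_right, ← smul_eq_mul, ← sum_const, ← sum_add_distrib]
    exact sum_le_sum fun a _ => le_tsub_add
  refine (Nat.pow_le_pow_left hlin _).trans ?_
  rw [hPsum]
  exact (pow_sum_le_card_mul_sum_pow (fun _ _ => Nat.zero_le _) K).trans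
    (Nat.mul_le_mul_left _ (sum_le_sum hfib))

theorem two_mul_pow_lt_of_pow_mul_lt {n C K m : ℕ} (hK : 1 ≤ K) (hm : 1 ≤ m)
    (hn : (8 * (K + 1) ^ 2) ^ K ≤ n)
    (hC : C ^ K * (4 * (K + 1) * ((K + 1) * m + 1) * ((K + 1) * K + 1)) < n ^ (K + 1)) :
    C ^ K * (2 * ((K + 1) * ((K + 1) * m)) * n ^ (K + 1)) <
      (n * (n - 1) - C * K) ^ (K + 1) := by
  have hn8 : 8 * (K + 1) ^ 2 ≤ n := (Nat.le_self_pow (by omega) _).trans hn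
  have hn0 : 0 < n := by nlinarith
  have hC2 : C * (8 * (K + 1) ^ 2) ≤ n ^ 2 := by
    obtain rfl | hK2 : K = 1 ∨ 2 ≤ K := by omega
    · norm_num at hC ⊢
      refine le_trans ?_ hC.le
      exact Nat.mul_le_mul_left _ (by omega)
    · rw [← Nat.pow_le_pow_iff_left (n := K) (by omega), mul_pow]
      have h1 : C ^ K ≤ n ^ (K + 1) := by
        refine le_trans (Nat.le_mul_of_pos_right _ (by positivity)) hC.le
      calc C ^ K * (8 * (K + 1) ^ 2) ^ K ≤ n ^ (K + 1) * n := Nat.mul_le_mul h1 hn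
        _ = n ^ (K + 2) := by ring
        _ ≤ n ^ (2 * K) := Nat.pow_le_pow_right hn0 (by omega)
        _ = (n ^ 2) ^ K := by rw [pow_mul]
  have hlow : (n : ℝ) ^ 2 * (1 - 1 / (2 * (K + 1))) ≤ ((n * (n - 1) - C * K : ℕ) : ℝ) := by
    have h1 : ((n * (n - 1) : ℕ) : ℝ) - ((C * K : ℕ) : ℝ) ≤ ((n * (n - 1) - C * K : ℕ) : ℝ) := by
      rw [sub_le_iff_le_add]
      exact_mod_cast le_tsub_add
    refine le_trans ?_ h1
    push_cast [Nat.cast_sub (show 1 ≤ n from hn0)]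
    have hC2' : (C : ℝ) * (8 * (K + 1) ^ 2) ≤ n ^ 2 := by exact_mod_cast hC2
    have hn8' : 8 * ((K : ℝ) + 1) ^ 2 ≤ n := by exact_mod_cast hn8
    have hK0 : (0 : ℝ) ≤ K := K.cast_nonneg
    have hCK : (C : ℝ) * K ≤ n ^ 2 * (1 / (4 * (K + 1))) := by
      rw [mul_one_div, le_div_iff₀ (by positivity)]
      nlinarith [mul_nonneg (C.cast_nonneg (α := ℝ)) hK0]
    have hnn : (n : ℝ) ≤ n ^ 2 * (1 / (4 * (K + 1))) := by
      rw [mul_one_div, le_div_iff₀ (by positivity)]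
      nlinarith [n.cast_nonneg (α := ℝ)]
    have hhalf : (1 : ℝ) / (2 * (K + 1)) = 1 / (4 * (K + 1)) + 1 / (4 * (K + 1)) := by
      field_simp
      norm_num
    rw [hhalf]
    linarith
  have hbern : (1 / 2 : ℝ) ≤ (1 - 1 / (2 * (K + 1))) ^ (K + 1) := by
    have hK0 : (0 : ℝ) ≤ K := K.cast_nonneg
    have h1 : (1 : ℝ) / (2 * (K + 1)) ≤ 1 := by
      rw [div_le_one (by positivity)]
      linarith
    have h2 := one_add_mul_le_pow (a := -((1 : ℝ) / (2 * (K + 1)))) (by linarith) (K + 1)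
    rw [← sub_eq_add_neg] at h2
    refine le_trans (le_of_eq ?_) h2
    push_cast
    field_simp
    norm_num
  have hpos : (0 : ℝ) ≤ (n : ℝ) ^ 2 * (1 - 1 / (2 * (K + 1))) := by
    have h1 : (1 : ℝ) / (2 * (K + 1)) ≤ 1 := by
      rw [div_le_one (by positivity)]
      linarith [K.cast_nonneg (α := ℝ)]
    exact mul_nonneg (by positivity) (by linarith)
  have hpow := pow_le_pow_left₀ hpos hlow (K + 1)
  rw [mul_pow] at hpow
  have hX : 2 * (C ^ K * (2 * ((K + 1) * ((K + 1) * m)) * n ^ (K + 1))) < (n ^ 2) ^ (K + 1) := by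
    calc 2 * (C ^ K * (2 * ((K + 1) * ((K + 1) * m)) * n ^ (K + 1)))
        = C ^ K * (4 * (K + 1) * ((K + 1) * m) * 1) * n ^ (K + 1) := by ring
      _ ≤ C ^ K * (4 * (K + 1) * ((K + 1) * m + 1) * ((K + 1) * K + 1)) * n ^ (K + 1) := by
          gcongr <;> omega
      _ < n ^ (K + 1) * n ^ (K + 1) := Nat.mul_lt_mul_of_pos_right hC (by positivity)
      _ = (n ^ 2) ^ (K + 1) := by ring
  have hX' : 2 * ((C ^ K * (2 * ((K + 1) * ((K + 1) * m)) * n ^ (K + 1)) : ℕ) : ℝ) <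
      ((n : ℝ) ^ 2) ^ (K + 1) := by exact_mod_cast hX
  have hfinal : ((n : ℝ) ^ 2) ^ (K + 1) * (1 / 2) ≤
      ((n * (n - 1) - C * K : ℕ) : ℝ) ^ (K + 1) :=
    le_trans (mul_le_mul_of_nonneg_left hbern (by positivity)) hpow
  have : ((C ^ K * (2 * ((K + 1) * ((K + 1) * m)) * n ^ (K + 1)) : ℕ) : ℝ) <
      ((n * (n - 1) - C * K : ℕ) : ℝ) ^ (K + 1) := by linarith
  exact_mod_cast this

/-- A proper colouring with few colours contains `K + 1` disjoint colour-isomorphic copies of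
every tree with `m` edges. -/
theorem hasRepeat_of_pow_mul_lt {V : Type} [Fintype V] {T : SimpleGraph V} (hT : T.IsTree)
    {n K m : ℕ} (hV : Fintype.card V = m + 1) (hK : 1 ≤ K) (hm : 1 ≤ m)
    (hn : (8 * (K + 1) ^ 2) ^ K ≤ n)
    {c : Fin n → Fin n → ℕ} (hc : IsProperEdgeColoring n c)
    (hC : numColors n c ^ K *
      (4 * (K + 1) * ((K + 1) * m + 1) * ((K + 1) * K + 1)) < n ^ (K + 1)) :
    HasRepeat n (K + 1) T c := by
  classical
  set U : Finset (Fin (K + 1) → Fin n) := {v | Function.Injective v} with hU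
  have hUcard : #U ≤ n ^ (K + 1) := by
    refine (card_filter_le _ _).trans ?_
    simp
  have hdense : 2 * ((K + 1) * ((K + 1) * m)) * #U <
      #{p ∈ U ×ˢ U | IsMonochromaticPair c p.1 p.2} := by
    refine lt_of_le_of_lt (Nat.mul_le_mul_left _ hUcard) ?_
    exact lt_of_mul_lt_mul_left ((two_mul_pow_lt_of_pow_mul_lt hK hm hn hC).trans_le
      (pow_le_card_isMonochromaticPair hc)) (Nat.zero_le _)
  obtain ⟨S, hSU, hS, hdeg⟩ := exists_subset_forall_lt_card_filter_s6 (IsMonochromaticPair c)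
    (fun _ _ h => h.symm hc) _ U hdense
  obtain ⟨φ, -, hφR, hφ⟩ := exists_tree_embedding hc S hS
    (fun v hv => (mem_filter.mp (hSU hv)).2) hdeg m V T hT hV le_rfl
  refine ⟨fun i u => φ u i, fun i u v huv => ?_, fun i j hij u v huv => ?_,
    fun i j u v huv => (hφR u v huv).2 i j⟩
  · exact congrArg Prod.fst (@hφ (u, i) (v, i) huv)
  · exact hij (congrArg Prod.snd (@hφ (u, i) (v, j) huv))

/-- A colouring with pairwise distinct edge colours has no repeats of a nonempty graph. -/
theorem exists_isProperEdgeColoring_not_hasRepeat (n : ℕ) {k : ℕ} (hk : 2 ≤ k) {V : Type}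
    {H : SimpleGraph V} {u v : V} (huv : H.Adj u v) :
    ∃ c : Fin n → Fin n → ℕ, IsProperEdgeColoring n c ∧ ¬ HasRepeat n k H c := by
  have := Fintype.toEncodable (Sym2 (Fin n))
  refine ⟨fun a b => Encodable.encode (s(a, b)), ⟨fun a b => ?_, ?_⟩, ?_⟩
  · dsimp only
    rw [Sym2.eq_swap]
  · intro a b b' _ _ hb h
    exact hb (Sym2.congr_right.mp (Encodable.encode_injective h))
  · rintro ⟨φ, -, hdisj, hcol⟩
    have h := Encodable.encode_injective (hcol ⟨0, by omega⟩ ⟨1, by omega⟩ u v huv)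
    rcases Sym2.eq_iff.mp h with h | h
    · exact hdisj _ _ (by simp) _ _ h.1
    · exact hdisj _ _ (by simp) _ _ h.1

/-- For any tree `T` with `m` edges and `k ≥ 2`, with
`q = (4k(km+1)(k²-k+1))^{1/(k-1)}`, one has `f_k(n,T) ≥ n^{k/(k-1)}/q`
for all sufficiently large `n`. -/
theorem stmt_6 (V : Type) [Fintype V] [DecidableEq V] (T : SimpleGraph V)
    [DecidableRel T.Adj] (hT : T.IsTree) (m : ℕ) (hm : 1 ≤ m)
    (hme : T.edgeFinset.card = m) (k : ℕ) (hk : 2 ≤ k) :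
    ∃ n₀ : ℕ, ∀ n ≥ n₀,
      (n : ℝ) ^ ((k : ℝ) / ((k : ℝ) - 1)) /
          ((4 * (k : ℝ) * ((k : ℝ) * m + 1) * ((k : ℝ) ^ 2 - k + 1)) ^
            ((1 : ℝ) / ((k : ℝ) - 1)))
        ≤ (repeatNumber k n T : ℝ) := by
  obtain ⟨K, rfl⟩ : ∃ K, k = K + 1 := ⟨k - 1, by omega⟩
  have hK : 1 ≤ K := by omega
  have hV : Fintype.card V = m + 1 := by rw [← hme, hT.card_edgeFinset]
  obtain ⟨e, he⟩ : T.edgeFinset.Nonempty := card_pos.mp (by omega)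
  refine ⟨(8 * (K + 1) ^ 2) ^ K, fun n hn => ?_⟩
  obtain ⟨c, hc, hnum, hrep⟩ : repeatNumber (K + 1) n T ∈ { C | ∃ c : Fin n → Fin n → ℕ,
      IsProperEdgeColoring n c ∧ numColors n c = C ∧ ¬ HasRepeat n (K + 1) T c } := by
    refine Nat.sInf_mem ?_
    induction e with
    | h u v =>
      obtain ⟨c, hc, hrep⟩ := exists_isProperEdgeColoring_not_hasRepeat n hk
        (SimpleGraph.mem_edgeFinset.mp he)
      exact ⟨_, c, hc, rfl, hrep⟩
  have hle : n ^ (K + 1) ≤ repeatNumber (K + 1) n T ^ K *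
      (4 * (K + 1) * ((K + 1) * m + 1) * ((K + 1) * K + 1)) := by
    by_contra! hlt
    rw [← hnum] at hlt
    exact hrep (hasRepeat_of_pow_mul_lt hT hV hK hm hn hc hlt)
  set C := repeatNumber (K + 1) n T
  have hKpos : (0 : ℝ) < K := by exact_mod_cast hK
  have hQ : 4 * ((K + 1 : ℕ) : ℝ) * (((K + 1 : ℕ) : ℝ) * m + 1) *
      (((K + 1 : ℕ) : ℝ) ^ 2 - (K + 1 : ℕ) + 1) =
      ((4 * (K + 1) * ((K + 1) * m + 1) * ((K + 1) * K + 1) : ℕ) : ℝ) := by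
    push_cast
    ring
  have hsub : ((K + 1 : ℕ) : ℝ) - 1 = K := by simp
  rw [hQ, hsub]
  set Q := 4 * (K + 1) * ((K + 1) * m + 1) * ((K + 1) * K + 1) with hQdef
  have hQpos : (0 : ℝ) < Q := by
    rw [hQdef]
    positivity
  rw [div_le_iff₀ (by positivity), ← mul_one_div, Real.rpow_mul n.cast_nonneg, Real.rpow_natCast]
  have hle' : (n : ℝ) ^ (K + 1) ≤ (C : ℝ) ^ K * Q := by exact_mod_cast hle
  refine (Real.rpow_le_rpow (by positivity) hle' (by positivity)).trans (le_of_eq ?_)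
  rw [Real.mul_rpow (by positivity) hQpos.le, one_div,
    Real.pow_rpow_inv_natCast C.cast_nonneg (by omega)]
end

section
/- For any tree T with m ≥ 1 edges and any k ≥ 2, there exist a constant c > 0 and n₀ such that for all n ≥ n₀, f_k(n,T) ≥ c·n^{(m+1)/m}. Equivalently, any proper edge-colouring of K_n with o(n^{(m+1)/m}) colours contains ω(1) pairwise vertex-disjoint, pairwise colour-isomorphic copies of T. -/
open Finset

/-- If a reflexive symmetric relation relates each element of `S` to at most `D` elements
of `S`, then any `S` with at least `k * D` elements contains `k` pairwise unrelated ones. -/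
theorem exists_pairwise_not_of_card_filter_le {α : Type*} [DecidableEq α] (R : α → α → Prop)
    [DecidableRel R] (hrefl : ∀ a, R a a) (hsymm : ∀ a b, R a b → R b a) (D : ℕ) (hD : 0 < D)
    (k : ℕ) : ∀ S : Finset α, (∀ a ∈ S, (S.filter (R a)).card ≤ D) → k * D ≤ S.card →
      ∃ t ⊆ S, t.card = k ∧ (t : Set α).Pairwise fun a b => ¬ R a b := by
  induction k with
  | zero => intro S _ _; exact ⟨∅, by simp, by simp, by simp⟩
  | succ k ih =>
    intro S hS hcard
    have hpos : 0 < S.card := by nlinarith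
    obtain ⟨a, ha⟩ := Finset.card_pos.1 hpos
    have hsplit := Finset.card_filter_add_card_filter_not (s := S) (R a)
    have hle := hS a ha
    obtain ⟨t, htS, htc, htp⟩ := ih (S.filter fun b => ¬ R a b)
      (fun b hb => (Finset.card_le_card
        (Finset.filter_subset_filter _ (Finset.filter_subset _ _))).trans
          (hS b (Finset.mem_filter.1 hb).1))
      (by rw [Nat.succ_mul] at hcard; omega)
    have hat : a ∉ t := fun h => (Finset.mem_filter.1 (htS h)).2 (hrefl a)
    refine ⟨insert a t, ?_, ?_, ?_⟩
    · exact Finset.insert_subset ha (htS.trans (Finset.filter_subset _ _))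
    · rw [Finset.card_insert_of_notMem hat, htc]
    · rw [Finset.coe_insert]
      refine htp.insert fun b hb _ => ?_
      have hab := (Finset.mem_filter.1 (htS hb)).2
      exact ⟨hab, fun h => hab (hsymm _ _ h)⟩

/-- In a proper edge colouring, a copy of a connected graph is determined by its colours
together with the image of one vertex. -/
theorem eq_of_colors_eq {n : ℕ} {c : Fin n → Fin n → ℕ} (hc : IsProperEdgeColoring n c)
    {V : Type*} {G : SimpleGraph V} (hG : G.Preconnected) {φ ψ : V ↪ Fin n}
    (h : ∀ u v, G.Adj u v → c (φ u) (φ v) = c (ψ u) (ψ v)) {v : V} (hv : φ v = ψ v) :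
    φ = ψ := by
  ext1 w
  obtain ⟨p⟩ := hG v w
  induction p with
  | nil => exact hv
  | @cons u x w hux p ih =>
    refine ih ?_
    by_contra hne
    have h1 := h u x hux
    rw [← hv] at h1
    exact hc.2 (φ u) (φ x) (ψ x) (φ.injective.ne hux.ne)
      (hv ▸ ψ.injective.ne hux.ne) hne h1

/-- Without `k` disjoint colour-isomorphic copies of a connected graph on `V`, each family of
colour-isomorphic copies has fewer than `k * |V| ^ 2` members. -/
theorem card_lt_of_not_hasRepeat {n k : ℕ} {c : Fin n → Fin n → ℕ}
    (hc : IsProperEdgeColoring n c) {V : Type*} [Fintype V] {G : SimpleGraph V}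
    (hG : G.Connected) (hrep : ¬ HasRepeat n k G c) (S : Finset (V ↪ Fin n))
    (hS : ∀ φ ∈ S, ∀ ψ ∈ S, ∀ u v, G.Adj u v → c (φ u) (φ v) = c (ψ u) (ψ v)) :
    S.card < k * Fintype.card V ^ 2 := by
  classical
  have := hG.nonempty
  by_contra! hcard
  obtain ⟨t, htS, htc, htp⟩ := exists_pairwise_not_of_card_filter_le
    (fun φ ψ : V ↪ Fin n => ∃ u v, φ u = ψ v)
    (fun φ => ⟨Classical.arbitrary V, _, rfl⟩)
    (fun φ ψ ⟨u, v, h⟩ => ⟨v, u, h.symm⟩) (Fintype.card V ^ 2)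
    (pow_pos Fintype.card_pos 2) k S (fun φ hφ => by
      have key : ∀ ψ : V ↪ Fin n, ∃ p : V × V, (∃ u v, φ u = ψ v) → φ p.1 = ψ p.2 := by
        intro ψ
        by_cases h : ∃ u v, φ u = ψ v
        · obtain ⟨u, v, h⟩ := h
          exact ⟨(u, v), fun _ => h⟩
        · exact ⟨Classical.arbitrary _, fun h' => absurd h' h⟩
      choose f hf using key
      have hle : (S.filter fun ψ => ∃ u v, φ u = ψ v).card
          ≤ (Finset.univ : Finset (V × V)).card := by
        refine Finset.card_le_card_of_injOn f (fun _ _ => by simp) ?_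
        intro ψ hψ χ hχ hfe
        simp only [Finset.coe_filter, Set.mem_ofPred_eq] at hψ hχ
        refine eq_of_colors_eq hc hG.preconnected (hS ψ hψ.1 χ hχ.1) (v := (f ψ).2) ?_
        rw [← hf ψ hψ.2, hfe, hf χ hχ.2]
      rwa [Finset.card_univ, Fintype.card_prod, ← sq] at hle) hcard
  let e := (Finset.equivFinOfCardEq htc).symm
  refine hrep ⟨fun i => (e i).1, fun i => (e i).1.injective, fun i j hij u v huv => ?_,
    fun i j => hS _ (htS (e i).2) _ (htS (e j).2)⟩
  exact htp (e i).2 (e j).2 (fun h => hij (e.injective (Subtype.ext h))) ⟨u, v, huv⟩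

/-- Counting the copies of a connected graph by their colour patterns. -/
theorem descFactorial_le_of_not_hasRepeat {n k : ℕ} {c : Fin n → Fin n → ℕ}
    (hc : IsProperEdgeColoring n c) {V : Type*} [Fintype V] {G : SimpleGraph V}
    [Fintype G.edgeSet] (hG : G.Connected) (hrep : ¬ HasRepeat n k G c) :
    n.descFactorial (Fintype.card V)
      ≤ k * Fintype.card V ^ 2 * numColors n c ^ G.edgeFinset.card := by
  classical
  let colors := (Finset.univ.filter fun p : Fin n × Fin n => p.1 ≠ p.2).image
    fun p => c p.1 p.2
  let pattern : (V ↪ Fin n) → G.edgeFinset → ℕ :=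
    fun φ e => c (φ (Quot.out e.1).1) (φ (Quot.out e.1).2)
  have hout : ∀ e : Sym2 V, s((Quot.out e).1, (Quot.out e).2) = e := fun e => Quot.out_eq e
  have hmaps : ∀ φ ∈ (Finset.univ : Finset (V ↪ Fin n)),
      pattern φ ∈ Fintype.piFinset fun _ : G.edgeFinset => colors := by
    intro φ _
    rw [Fintype.mem_piFinset]
    intro e
    have he : G.Adj (Quot.out e.1).1 (Quot.out e.1).2 := by
      rw [← SimpleGraph.mem_edgeSet, hout]
      exact SimpleGraph.mem_edgeFinset.1 e.2
    exact Finset.mem_image.2 ⟨(φ (Quot.out e.1).1, φ (Quot.out e.1).2),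
      by simpa using he.ne, rfl⟩
  have hcount := Finset.card_le_mul_card_image_of_maps_to hmaps (k * Fintype.card V ^ 2)
    (fun b _ => by
      refine (card_lt_of_not_hasRepeat hc hG hrep _ ?_).le
      intro φ hφ ψ hψ u v huv
      have hpat : pattern φ = pattern ψ :=
        (Finset.mem_filter.1 hφ).2.trans (Finset.mem_filter.1 hψ).2.symm
      have hp := congrFun hpat ⟨s(u, v), SimpleGraph.mem_edgeFinset.2 huv⟩
      simp only [pattern] at hp
      rcases Sym2.eq_iff.1 (hout s(u, v)) with ⟨h1, h2⟩ | ⟨h1, h2⟩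
      · rwa [h1, h2] at hp
      · rw [h1, h2] at hp
        rw [hc.1 (φ u), hc.1 (ψ u), hp])
  rw [Finset.card_univ, Fintype.card_embedding_eq, Fintype.card_fin, Fintype.card_piFinset,
    Finset.prod_const, Finset.card_univ,
    Fintype.card_coe] at hcount
  exact hcount

/-- Colourings without `k ≥ 2` disjoint colour-isomorphic copies of a graph with an edge exist,
so `repeatNumber` is attained. -/
theorem exists_numColors_eq_repeatNumber (n k : ℕ) (hk : 2 ≤ k) {V : Type*} {G : SimpleGraph V}
    {x y : V} (hxy : G.Adj x y) :
    ∃ c : Fin n → Fin n → ℕ,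
      IsProperEdgeColoring n c ∧ numColors n c = repeatNumber k n G ∧ ¬ HasRepeat n k G c := by
  refine Nat.sInf_mem (s := { C | ∃ c : Fin n → Fin n → ℕ,
    IsProperEdgeColoring n c ∧ numColors n c = C ∧ ¬ HasRepeat n k G c }) ?_
  obtain ⟨f, hf⟩ := exists_injective_nat (Sym2 (Fin n))
  refine ⟨_, fun a b => f s(a, b), ⟨fun a b => congrArg f Sym2.eq_swap, ?_⟩, rfl, ?_⟩
  · intro a b b' _ _ hb h
    exact hb (Sym2.congr_right.1 (hf h))
  · rintro ⟨φ, _, hdisj, hcol⟩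
    have hij : (⟨0, by omega⟩ : Fin k) ≠ ⟨1, by omega⟩ := by simp
    rcases Sym2.eq_iff.1 (hf (hcol ⟨0, by omega⟩ ⟨1, by omega⟩ x y hxy)) with h | h
    · exact hdisj _ _ hij _ _ h.1
    · exact hdisj _ _ hij _ _ h.1

/-- For any tree `T` with `m ≥ 1` edges and any `k ≥ 2`, `f_k(n,T) = Ω(n^{(m+1)/m})`. -/
theorem stmt_8 (V : Type) [Fintype V] [DecidableEq V] (T : SimpleGraph V)
    [DecidableRel T.Adj] (hT : T.IsTree) (m : ℕ) (hm : 1 ≤ m)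
    (hme : T.edgeFinset.card = m) (k : ℕ) (hk : 2 ≤ k) :
    ∃ c : ℝ, 0 < c ∧ ∃ n₀ : ℕ, ∀ n ≥ n₀,
      c * (n : ℝ) ^ (((m : ℝ) + 1) / (m : ℝ)) ≤ (repeatNumber k n T : ℝ) := by
  have hV : Fintype.card V = m + 1 := by rw [← hT.card_edgeFinset, hme]
  have hm0 : m ≠ 0 := by omega
  have hmR : (m : ℝ) ≠ 0 := by exact_mod_cast hm0
  obtain ⟨x, y, hxy⟩ : ∃ x y, T.Adj x y := by
    obtain ⟨e, he⟩ := Finset.card_pos.1 (by omega : 0 < T.edgeFinset.card)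
    induction e with
    | h x y => exact ⟨x, y, SimpleGraph.mem_edgeFinset.1 he⟩
  have hkR : (0 : ℝ) < k := by exact_mod_cast (by omega : 0 < k)
  set K : ℝ := k * ((m : ℝ) + 1) ^ 2 with hK
  have hKpos : 0 < K := by positivity
  set A : ℝ := (2 ^ (m + 1) * K)⁻¹ with hA
  have hApos : 0 < A := by positivity
  refine ⟨A ^ ((m : ℝ)⁻¹), by positivity, 2 * m, fun n hn => ?_⟩
  obtain ⟨c, hc, hnum, hrep⟩ := exists_numColors_eq_repeatNumber n k hk hxy
  have hcount := descFactorial_le_of_not_hasRepeat hc hT.connected hrep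
  rw [hV, hme, hnum] at hcount
  have hcountR : ((n : ℝ) / 2) ^ (m + 1) ≤ K * (repeatNumber k n T : ℝ) ^ m := by
    have h1 : ((n - m : ℕ) : ℝ) ^ (m + 1) ≤ K * (repeatNumber k n T : ℝ) ^ m := by
      have h2 := (Nat.pow_sub_le_descFactorial n (m + 1)).trans hcount
      rw [Nat.add_sub_add_right] at h2
      rw [hK]
      exact_mod_cast h2
    refine (pow_le_pow_left₀ (by positivity) ?_ _).trans h1
    rw [Nat.cast_sub (by omega)]
    have : (2 * m : ℝ) ≤ n := by exact_mod_cast hn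
    linarith
  refine le_of_pow_le_pow_left₀ hm0 (Nat.cast_nonneg _) ?_
  rw [mul_pow, Real.rpow_inv_natCast_pow hApos.le hm0, ← Real.rpow_natCast (_ ^ _),
    ← Real.rpow_mul (Nat.cast_nonneg _), div_mul_cancel₀ _ hmR, ← Nat.cast_add_one,
    Real.rpow_natCast, hA, inv_mul_le_iff₀ (by positivity)]
  rw [div_pow, div_le_iff₀ (by positivity)] at hcountR
  linarith
end
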